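/- arXiv:1910.13853 — 3 statements merged into one kernel-verified Lean document; each statement's English description precedes it below -/
import Mathlib

section
/- For every integer n ≥ 4, there exist two non-isomorphic level-2 phylogenetic networks on the same set X of n leaves such that d_m^{N}(x,y) = d_m^{N'}(x,y) for all leaves x, y ∈ X, i.e., the two networks have the same shortest distance matrix. -/
open SimpleGraph

/-- A labelled graph: the raw data of a phylogenetic network on a label set `X`:
a finite vertex type, a simple graph on it, and a labelling map from `X` to vertices. -/
structure LabGraph (X : Type) where
  V : Type
  [fV : Fintype V]
  G : SimpleGraph V
  leaf : X → V

attribute [instance] LabGraph.fV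

namespace LabGraph

variable {X : Type} [Fintype X] [DecidableEq X]

/-- The shortest distance `d_m(x,y)` between the leaves labelled `x` and `y`. -/
noncomputable def dm (N : LabGraph X) (x y : X) : ℕ :=
  N.G.dist (N.leaf x) (N.leaf y)

/-- The multiset `d(x,y)` of the lengths of all paths between the leaves `x` and `y`. -/
noncomputable def dms (N : LabGraph X) (x y : X) : Multiset ℕ := by
  classical
  exact (Finset.univ : Finset (N.G.Path (N.leaf x) (N.leaf y))).val.map fun p => p.1.length

/-- The degree of a vertex. -/
noncomputable def degOf (N : LabGraph X) (v : N.V) : ℕ := (N.G.neighborSet v).ncard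

/-- `N` is an (unweighted unrooted binary) phylogenetic network on `X`:
it is connected, the labelling is injective, and either it is the singleton graph
(when `|X| = 1`), or every leaf-labelled vertex has degree 1 and every other
vertex has degree 3 (so the degree-1 vertices are exactly the labelled leaves). -/
def IsNetwork (N : LabGraph X) : Prop :=
  N.G.Connected ∧ Function.Injective N.leaf ∧
    ((Fintype.card X = 1 ∧ Fintype.card N.V = 1) ∨
      ((∀ x : X, N.degOf (N.leaf x) = 1) ∧
        ∀ v : N.V, v ∉ Set.range N.leaf → N.degOf v = 3))

/-- Two labelled graphs on `X` are isomorphic by a graph isomorphism fixing the leaf labels. -/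
def IsomLabelled (N M : LabGraph X) : Prop :=
  ∃ φ : N.G ≃g M.G, ∀ x : X, φ (N.leaf x) = M.leaf x

/-- A subgraph is 2-connected (with at least three vertices): it is connected and
remains connected after deleting any one of its vertices. -/
def TwoConnSub (N : LabGraph X) (H : N.G.Subgraph) : Prop :=
  3 ≤ H.verts.ncard ∧ H.coe.Connected ∧
    ∀ v ∈ H.verts, (H.deleteVerts {v}).coe.Connected

/-- A blob: a maximal 2-connected subgraph with at least three vertices. -/
def IsBlob (N : LabGraph X) (H : N.G.Subgraph) : Prop :=
  N.TwoConnSub H ∧ ∀ H' : N.G.Subgraph, N.TwoConnSub H' → H ≤ H' → H' = H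

/-- Exactly `r` edges must be deleted from the (connected) subgraph `H` to obtain a
tree: `|E(H)| - |V(H)| + 1 = r`.  A level-1 blob has rank 1, a level-2 blob rank 2. -/
def BlobRank (N : LabGraph X) (H : N.G.Subgraph) (r : ℕ) : Prop :=
  H.edgeSet.ncard + 1 = H.verts.ncard + r

/-- A network is level-`k` if at most `k` edges must be deleted from every blob
to obtain a tree. -/
def IsLevel (N : LabGraph X) (k : ℕ) : Prop :=
  ∀ H : N.G.Subgraph, N.IsBlob H → H.edgeSet.ncard + 1 ≤ H.verts.ncard + k

/-- A cut-edge: an edge whose deletion disconnects the graph. -/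
def IsCutEdge (N : LabGraph X) (e : Sym2 N.V) : Prop :=
  e ∈ N.G.edgeSet ∧ ¬ (N.G.deleteEdges {e}).Connected

/-- A trivial (cut-)edge: one incident to a leaf. -/
def TrivialEdge (N : LabGraph X) (e : Sym2 N.V) : Prop :=
  ∃ x : X, N.leaf x ∈ e

/-- An edge is incident to a blob if one of its endpoints is a vertex of the blob. -/
def EdgeIncBlob (N : LabGraph X) (e : Sym2 N.V) (H : N.G.Subgraph) : Prop :=
  ∃ v ∈ H.verts, v ∈ e

/-- A pendant blob: a blob with exactly one incident non-trivial cut-edge. -/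
def IsPendantBlob (N : LabGraph X) (H : N.G.Subgraph) : Prop :=
  N.IsBlob H ∧
    ∃! e : Sym2 N.V, N.IsCutEdge e ∧ ¬ N.TrivialEdge e ∧ N.EdgeIncBlob e H

/-- A leaf is contained in a blob if its neighbour is a vertex of the blob. -/
def LeafInBlob (N : LabGraph X) (x : X) (H : N.G.Subgraph) : Prop :=
  ∃ v : N.V, N.G.Adj (N.leaf x) v ∧ v ∈ H.verts

/-- `N` has at least two blobs. -/
def TwoBlobs (N : LabGraph X) : Prop :=
  ∃ H₁ H₂ : N.G.Subgraph, N.IsBlob H₁ ∧ N.IsBlob H₂ ∧ H₁ ≠ H₂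

/-- Every leaf of `N` is contained in a blob. -/
def AllLeavesInBlobs (N : LabGraph X) : Prop :=
  ∀ x : X, ∃ H : N.G.Subgraph, N.IsBlob H ∧ N.LeafInBlob x H

/-- A chain: a `k`-tuple of leaves with consecutive shortest distances equal to 3. -/
def IsChainT (N : LabGraph X) (k : ℕ) (a : Fin k → X) : Prop :=
  ∀ (i : ℕ) (h : i + 1 < k),
    N.dm (a ⟨i, Nat.lt_of_succ_lt h⟩) (a ⟨i + 1, h⟩) = 3

/-- A maximal chain: a chain whose leaf set is not properly contained in the leaf
set of another chain. -/
def IsMaxChainT (N : LabGraph X) (k : ℕ) (a : Fin k → X) : Prop :=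
  N.IsChainT k a ∧ ∀ (l : ℕ) (b : Fin l → X), N.IsChainT l b →
    Set.range a ⊆ Set.range b → Set.range a = Set.range b

/-- The chain `a` is contained in the blob `H`: the edges between the neighbours of
consecutive chain leaves are edges of `H`. -/
def ChainInBlob (N : LabGraph X) (k : ℕ) (a : Fin k → X) (H : N.G.Subgraph) : Prop :=
  ∀ (i : ℕ) (h : i + 1 < k) (p q : N.V),
    N.G.Adj (N.leaf (a ⟨i, Nat.lt_of_succ_lt h⟩)) p →
    N.G.Adj (N.leaf (a ⟨i + 1, h⟩)) q → H.Adj p q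

/-- The multiset of natural numbers `A`, viewed in `ℤ`. -/
def toZ (A : Multiset ℕ) : Multiset ℤ := A.map (fun t => (t : ℤ))

/-- `A - n`: subtract `n` from every element of the multiset `A` (in `ℤ`). -/
def zsub (A : Multiset ℕ) (n : ℤ) : Multiset ℤ := A.map (fun t => (t : ℤ) - n)

namespace Aux

/-! ### Generic lemmas -/

/-- A certificate for graph distances. -/
lemma dist_of_cert {V : Type} (G : SimpleGraph V) (t : V) (f : V → ℕ) (h0 : f t = 0)
    (h1 : ∀ u v, G.Adj u v → f u ≤ f v + 1)
    (h2 : ∀ v, v ≠ t → ∃ w, G.Adj v w ∧ f w + 1 = f v) (v : V) : G.dist v t = f v := by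
  have hw : ∀ n v, f v = n → ∃ p : G.Walk v t, p.length = n := by
    intro n
    induction n with
    | zero =>
      intro v hv
      by_cases h : v = t
      · subst h; exact ⟨.nil, rfl⟩
      · obtain ⟨w, _, hw⟩ := h2 v h
        omega
    | succ n ih =>
      intro v hv
      have h : v ≠ t := by rintro rfl; omega
      obtain ⟨w, ha, hw⟩ := h2 v h
      obtain ⟨p, hp⟩ := ih w (by omega)
      exact ⟨.cons ha p, by simp [hp]⟩
  have hl : ∀ (a b : V) (p : G.Walk a b), f a ≤ f b + p.length := by
    intro a b p
    induction p with
    | nil => simp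
    | cons ha p ih =>
      have := h1 _ _ ha
      simp only [Walk.length_cons]
      omega
  obtain ⟨p, hp⟩ := hw _ v rfl
  apply le_antisymm
  · rw [← hp]; exact G.dist_le p
  · obtain ⟨q, hq⟩ := (p.reachable).exists_walk_length_eq_dist
    have := hl _ _ q
    omega

/-- Connected graphs have an edge crossing every nontrivial vertex set. -/
lemma exists_cross {V : Type} {G : SimpleGraph V} (hc : G.Preconnected) (A : Set V) {a b : V}
    (ha : a ∈ A) (hb : b ∉ A) : ∃ u v, G.Adj u v ∧ u ∈ A ∧ v ∉ A := by
  obtain ⟨p⟩ := hc a b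
  obtain ⟨d, _, h1, h2⟩ := p.exists_boundary_dart A ha hb
  exact ⟨d.fst, d.snd, d.adj, h1, h2⟩

lemma sub_cross {V : Type} {G : SimpleGraph V} (H : G.Subgraph) (hc : H.coe.Connected)
    (A : Set V) {a b : V} (haH : a ∈ H.verts) (hbH : b ∈ H.verts)
    (ha : a ∈ A) (hb : b ∉ A) : ∃ u v, H.Adj u v ∧ u ∈ A ∧ v ∉ A := by
  obtain ⟨u, v, h, h1, h2⟩ := exists_cross hc.preconnected (Subtype.val ⁻¹' A)
    (a := ⟨a, haH⟩) (b := ⟨b, hbH⟩) ha hb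
  exact ⟨u, v, h, h1, h2⟩

/-- A 2-connected subgraph lies on one side of a bridge. -/
lemma one_side {X : Type} (N : LabGraph X) (H : N.G.Subgraph) (hH : N.TwoConnSub H)
    (A : Set N.V) (p q : N.V)
    (hA : ∀ u v, N.G.Adj u v → u ∈ A → v ∉ A → u = p ∧ v = q) :
    (∀ v ∈ H.verts, v ∈ A) ∨ (∀ v ∈ H.verts, v ∉ A) := by
  by_contra hcon
  push Not at hcon
  obtain ⟨⟨b, hbH, hb⟩, ⟨a, haH, ha⟩⟩ := hcon
  obtain ⟨h3, hc, hd⟩ := hH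
  obtain ⟨u, v, huv, hu, hv⟩ := sub_cross H hc A haH hbH ha hb
  obtain ⟨rfl, rfl⟩ := hA u v huv.adj_sub hu hv
  have hz : ∃ z ∈ H.verts, z ≠ u ∧ z ≠ v := by
    by_contra hcon
    push Not at hcon
    have hsub : H.verts ⊆ {u, v} := by
      intro z hz
      by_cases h : z = u
      · simp [h]
      · simp [hcon z hz h]
    have h1 := Set.ncard_le_ncard hsub
    have h2 := Set.ncard_insert_le u {v}
    simp only [Set.ncard_singleton] at h2
    omega
  obtain ⟨z, hzH, hzu, hzv⟩ := hz
  by_cases hzA : z ∈ A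
  · obtain ⟨u', v', h', hu', hv'⟩ := sub_cross _ (hd u huv.fst_mem) A (a := z) (b := v)
      (by simp [hzH, hzu]) (by simpa [huv.snd_mem] using huv.adj_sub.ne') hzA hv
    obtain ⟨rfl, rfl⟩ := hA u' v' h'.adj_sub hu' hv'
    have := h'.fst_mem
    simp at this
  · obtain ⟨u', v', h', hu', hv'⟩ := sub_cross _ (hd v huv.snd_mem) A (a := u) (b := z)
      (by simpa [huv.fst_mem] using huv.adj_sub.ne) (by simp [hzH, hzv]) hu hzA
    obtain ⟨rfl, rfl⟩ := hA u' v' h'.adj_sub hu' hv'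
    have := h'.snd_mem
    simp at this

/-- Counting edges relative to a rooted forest and a set of extra edges. -/
lemma edge_count {m : ℕ} (G : SimpleGraph (Fin m)) (H : G.Subgraph) (hne : H.verts.Nonempty)
    (par : Fin m → Fin m) (S : Finset (Sym2 (Fin m)))
    (h : ∀ u v, H.Adj u v → v < u → v = par u ∨ s(u, v) ∈ S) :
    H.edgeSet.ncard + 1 ≤ H.verts.ncard + S.card := by
  classical
  obtain ⟨v0, hv0, hmin⟩ := Set.exists_min_image H.verts id (Set.toFinite _) hne
  have hsub : H.edgeSet ⊆ ((fun u => s(u, par u)) '' (H.verts \ {v0})) ∪ (S : Set (Sym2 (Fin m))) := by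
    have key : ∀ u v, H.Adj u v → v < u → s(u, v) ∈
        ((fun u => s(u, par u)) '' (H.verts \ {v0})) ∪ (S : Set (Sym2 (Fin m))) := by
      intro u v huv hlt
      rcases h u v huv hlt with h' | h'
      · left
        refine ⟨u, ⟨huv.fst_mem, ?_⟩, by simp [h']⟩
        rintro rfl
        exact absurd (hmin v huv.snd_mem) (by simpa using hlt)
      · right; exact h'
    intro e
    induction e using Sym2.ind with
    | _ u v =>
      intro he
      have huv : H.Adj u v := he
      rcases lt_trichotomy u v with hlt | heq | hlt
      · rw [Sym2.eq_swap]; exact key v u huv.symm hlt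
      · exact absurd heq huv.adj_sub.ne
      · exact key u v huv hlt
  have h1 := Set.ncard_le_ncard hsub
  have h2 := Set.ncard_union_le ((fun u => s(u, par u)) '' (H.verts \ {v0})) (S : Set (Sym2 (Fin m)))
  have h3 := Set.ncard_image_le (f := fun u => s(u, par u)) (Set.toFinite (H.verts \ {v0}))
  have h4 := Set.ncard_sdiff_singleton_add_one hv0
  rw [Set.ncard_coe_finset] at h2
  omega

/-! ### The networks -/

/-- The downward relation: core pairs, and the caterpillar tail hanging off vertex 9. -/
def R (L : List (ℕ × ℕ)) (u v : ℕ) : Prop :=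
  (u, v) ∈ L ∨ (11 ≤ u ∧ u % 2 = 1 ∧ v + 2 = u) ∨ (12 ≤ u ∧ u % 2 = 0 ∧ v + 1 = u)

def gr (L : List (ℕ × ℕ)) (k : ℕ) : SimpleGraph (Fin (12 + 2 * k)) :=
  SimpleGraph.fromRel (fun u v => R L u v)

/-- Position of the leaves. -/
def lf (k : ℕ) (j : Fin (k + 4)) : Fin (12 + 2 * k) :=
  if j.val = 0 then ⟨7, by omega⟩ else if j.val = 1 then ⟨8, by omega⟩
  else if j.val = 2 then ⟨10, by omega⟩
  else if h : j.val = k + 3 then ⟨11 + 2 * k, by omega⟩ else ⟨6 + 2 * j.val, by omega⟩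

def net {X : Type} (k : ℕ) (e : X ≃ Fin (k + 4)) (L : List (ℕ × ℕ)) : LabGraph X where
  V := Fin (12 + 2 * k)
  G := gr L k
  leaf := fun x => lf k (e x)

lemma lf_inj (k : ℕ) : Function.Injective (lf k) := by
  intro a b h
  have h' := congrArg Fin.val h
  unfold lf at h'
  apply Fin.ext
  split_ifs at h' <;> simp at h' <;> omega

lemma lf_cases (k : ℕ) (j : Fin (k + 4)) : (lf k j).val = 7 ∨ (lf k j).val = 8 ∨
    (lf k j).val = 10 ∨ (lf k j).val = 11 + 2 * k ∨
      (12 ≤ (lf k j).val ∧ (lf k j).val % 2 = 0) := by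
  unfold lf
  split_ifs <;> simp <;> omega

lemma lf_range (k : ℕ) (v : Fin (12 + 2 * k)) (h : v.val = 7 ∨ v.val = 8 ∨
    v.val = 10 ∨ v.val = 11 + 2 * k ∨ (12 ≤ v.val ∧ v.val % 2 = 0)) : ∃ j, lf k j = v := by
  have hv := v.2
  rcases h with h | h | h | h | h
  · exact ⟨⟨0, by omega⟩, by simp [lf, Fin.ext_iff, h]⟩
  · exact ⟨⟨1, by omega⟩, by simp [lf, Fin.ext_iff, h]⟩
  · exact ⟨⟨2, by omega⟩, by simp [lf, Fin.ext_iff, h]⟩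
  · exact ⟨⟨k + 3, by omega⟩, by simp [lf, Fin.ext_iff, h]⟩
  · refine ⟨⟨(v.val - 6) / 2, by omega⟩, ?_⟩
    unfold lf
    apply Fin.ext
    split_ifs <;> simp at * <;> omega

/-- Core lists: pairs are decreasing and inside `{0,…,10}`. -/
def Ok (L : List (ℕ × ℕ)) : Prop := ∀ e ∈ L, e.2 < e.1 ∧ e.1 < 11

lemma R_lt {L} (hL : Ok L) {u v : ℕ} (h : R L u v) : v < u := by
  rcases h with h | h | h
  · exact (hL _ h).1
  · omega
  · omega

lemma gr_adj {L} (hL : Ok L) {k : ℕ} {u v : Fin (12 + 2 * k)} :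
    (gr L k).Adj u v ↔ R L u v ∨ R L v u := by
  unfold gr
  rw [SimpleGraph.fromRel_adj]
  constructor
  · exact fun h => h.2
  · intro h
    refine ⟨?_, h⟩
    rintro rfl
    rcases h with h | h <;> exact absurd (R_lt hL h) (lt_irrefl _)

/-- Connectedness. -/
lemma gr_conn {L} (hL : Ok L) (hp : ∀ v < 11, v ≠ 0 → ∃ w < 11, (v, w) ∈ L) (k : ℕ) :
    (gr L k).Connected := by
  have key : ∀ n (v : Fin (12 + 2 * k)), v.val = n → (gr L k).Reachable v ⟨0, by omega⟩ := by
    intro n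
    induction n using Nat.strong_induction_on with
    | _ n ih =>
      intro v hv
      by_cases h0 : n = 0
      · have : v = ⟨0, by omega⟩ := Fin.ext (by change v.val = 0; omega)
        rw [this]
      · have : ∃ w, R L v.val w := by
          by_cases h11 : v.val < 11
          · obtain ⟨w, _, hw⟩ := hp v.val h11 (by omega)
            exact ⟨w, Or.inl hw⟩
          · by_cases hev : v.val % 2 = 0
            · exact ⟨v.val - 1, Or.inr (Or.inr (by omega))⟩
            · exact ⟨v.val - 2, Or.inr (Or.inl (by omega))⟩
        obtain ⟨w, hw⟩ := this
        have hlt := R_lt hL hw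
        have hv2 := v.2
        have hwr := ih w (by omega) ⟨w, by omega⟩ rfl
        have hadj : (gr L k).Adj v ⟨w, by omega⟩ := (gr_adj hL).2 (Or.inl hw)
        exact hadj.reachable.trans hwr
  haveI : Nonempty (Fin (12 + 2 * k)) := ⟨⟨0, by omega⟩⟩
  exact SimpleGraph.Connected.mk (fun u v => (key _ u rfl).trans (key _ v rfl).symm)

lemma deg_one {L} (hL : Ok L) {k : ℕ} (v : Fin (12 + 2 * k)) (a : ℕ) (ha : a < 12 + 2 * k)
    (h : ∀ w < 12 + 2 * k, (R L v w ∨ R L w v) ↔ w = a) :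
    ((gr L k).neighborSet v).ncard = 1 := by
  have : (gr L k).neighborSet v = {⟨a, ha⟩} := by
    ext w
    rw [SimpleGraph.mem_neighborSet, gr_adj hL, h w.val w.2]
    simp [Fin.ext_iff]
  rw [this, Set.ncard_singleton]

lemma deg_three {L} (hL : Ok L) {k : ℕ} (v : Fin (12 + 2 * k)) (a b c : ℕ)
    (ha : a < 12 + 2 * k) (hb : b < 12 + 2 * k) (hc : c < 12 + 2 * k)
    (hab : a ≠ b) (hac : a ≠ c) (hbc : b ≠ c)
    (h : ∀ w < 12 + 2 * k, (R L v w ∨ R L w v) ↔ (w = a ∨ w = b ∨ w = c)) :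
    ((gr L k).neighborSet v).ncard = 3 := by
  have : (gr L k).neighborSet v = {⟨a, ha⟩, ⟨b, hb⟩, ⟨c, hc⟩} := by
    ext w
    rw [SimpleGraph.mem_neighborSet, gr_adj hL, h w.val w.2]
    simp [Fin.ext_iff]
  rw [this, Set.ncard_eq_three]
  exact ⟨_, _, _, by simpa [Fin.ext_iff] using hab, by simpa [Fin.ext_iff] using hac,
    by simpa [Fin.ext_iff] using hbc, rfl⟩

/-- Adjacency from a core vertex other than 9 is core adjacency. -/
lemma core_R {L} (hL : Ok L) {v : ℕ} (hv : v < 11) (w : ℕ) :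
    (R L v w ∨ R L w v) ↔ ((v, w) ∈ L ∨ (w, v) ∈ L) ∨ (v = 9 ∧ w = 11) := by
  unfold R
  constructor
  · rintro ((h | h | h) | (h | h | h))
    · exact Or.inl (Or.inl h)
    · omega
    · omega
    · exact Or.inl (Or.inr h)
    · right; omega
    · omega
  · rintro ((h | h) | h)
    · exact Or.inl (Or.inl h)
    · exact Or.inr (Or.inl h)
    · right; right; left; omega

lemma tail_R {L} (hL : Ok L) {v : ℕ} (hv : 11 ≤ v) (w : ℕ) :
    (R L v w ∨ R L w v) ↔ (v % 2 = 1 ∧ (w + 2 = v ∨ w = v + 1 ∨ w = v + 2)) ∨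
      (v % 2 = 0 ∧ w + 1 = v) := by
  have h1 : (v, w) ∉ L := fun h => by have := hL _ h; simp at this; omega
  have h2 : (w, v) ∉ L := fun h => by have := hL _ h; simp at this; omega
  unfold R
  simp only [h1, h2, false_or]
  omega

lemma mem_lt {L} (hL : Ok L) {v w : ℕ} (h : (v, w) ∈ L ∨ (w, v) ∈ L) : w < 11 := by
  rcases h with h | h
  · have := hL _ h; simp at this; omega
  · have := hL _ h; simp at this; omega

/-- All the finite facts about a core used below. `nb` lists neighbours. -/
structure Core (L : List (ℕ × ℕ)) (nb : ℕ → List ℕ) : Prop where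
  ok : Ok L
  par : ∀ v < 11, v ≠ 0 → ∃ w < 11, (v, w) ∈ L
  nbs : ∀ v < 11, ∀ w < 11, ((v, w) ∈ L ∨ (w, v) ∈ L) ↔ w ∈ nb v
  n7 : nb 7 = [0]
  n8 : nb 8 = [1]
  n10 : nb 10 = [6]
  len : ∀ v < 11, v ≠ 7 → v ≠ 8 → v ≠ 10 → (v = 9 → (nb v).length = 2) ∧
    (v ≠ 9 → (nb v).length = 3) ∧ (nb v).Nodup ∧ ∀ w ∈ nb v, w < 11

lemma core_nb {L nb} (C : Core L nb) {v : ℕ} (hv : v < 11) (w : ℕ)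
    (hb : ∀ w ∈ nb v, w < 11) :
    (R L v w ∨ R L w v) ↔ w ∈ nb v ∨ (v = 9 ∧ w = 11) := by
  rw [core_R C.ok hv]
  by_cases hw : w < 11
  · rw [C.nbs v hv w hw]
  · have h1 : ¬ ((v, w) ∈ L ∨ (w, v) ∈ L) := fun h => hw (mem_lt C.ok h)
    have h2 : w ∉ nb v := fun h => hw (hb w h)
    simp [h1, h2]

lemma net_isNetwork {X : Type} [Fintype X] {L nb} (C : Core L nb) (k : ℕ)
    (e : X ≃ Fin (k + 4)) : (net k e L).IsNetwork := by
  refine ⟨gr_conn C.ok C.par k, (lf_inj k).comp e.injective, Or.inr ⟨?_, ?_⟩⟩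
  · intro x
    change ((gr L k).neighborSet (lf k (e x))).ncard = 1
    have hlt := (lf k (e x)).2
    rcases lf_cases k (e x) with h | h | h | h | h
    · refine deg_one C.ok _ 0 (by omega) fun w hw => ?_
      rw [core_nb C (by omega) w (by simp [h, C.n7]), h, C.n7]; simp
    · refine deg_one C.ok _ 1 (by omega) fun w hw => ?_
      rw [core_nb C (by omega) w (by simp [h, C.n8]), h, C.n8]; simp
    · refine deg_one C.ok _ 6 (by omega) fun w hw => ?_
      rw [core_nb C (by omega) w (by simp [h, C.n10]), h, C.n10]; simp
    · refine deg_one C.ok _ (9 + 2 * k) (by omega) fun w hw => ?_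
      rw [tail_R C.ok (by omega) w]; omega
    · refine deg_one C.ok _ ((lf k (e x)).val - 1) (by omega) fun w hw => ?_
      rw [tail_R C.ok (by omega) w]; omega
  · intro v hv
    change ((gr L k).neighborSet v).ncard = 3
    change Fin (12 + 2 * k) at v
    have hnl : ¬ (v.val = 7 ∨ v.val = 8 ∨ v.val = 10 ∨ v.val = 11 + 2 * k ∨
        (12 ≤ v.val ∧ v.val % 2 = 0)) := by
      intro h
      obtain ⟨j, hj⟩ := lf_range k v h
      exact hv ⟨e.symm j, by simp [net, hj]⟩
    have hlt := v.2
    by_cases h11 : v.val < 11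
    · obtain ⟨h9, hn9, hnd, hb⟩ := C.len v.val h11 (by omega) (by omega) (by omega)
      by_cases h : v.val = 9
      · obtain ⟨a, b, hl⟩ := List.length_eq_two.1 (h9 h)
        rw [hl] at hnd hb
        simp at hnd hb
        refine deg_three C.ok v a b 11 (by omega) (by omega) (by omega) hnd (by omega)
          (by omega) fun w hw => ?_
        rw [core_nb C h11 w (by simp [hl, hb]), hl]
        simp [h, or_assoc]
      · obtain ⟨a, b, c, hl⟩ := List.length_eq_three.1 (hn9 h)
        rw [hl] at hnd hb
        simp at hnd hb
        refine deg_three C.ok v a b c (by omega) (by omega) (by omega) hnd.1.1 hnd.1.2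
          hnd.2 fun w hw => ?_
        rw [core_nb C h11 w (by simp [hl, hb]), hl]
        simp [h]
    · refine deg_three C.ok v (v.val - 2) (v.val + 1) (v.val + 2) (by omega) (by omega) (by omega)
        (by omega) (by omega) (by omega) fun w hw => ?_
      rw [tail_R C.ok (by omega) w]; omega

/-- Level: a bridge `p q` and parent/extra edges. -/
lemma net_isLevel {X : Type} {L : List (ℕ × ℕ)} (hL : Ok L) (k : ℕ)
    (e : X ≃ Fin (k + 4)) (A : ℕ → Prop) (p q : ℕ) (hp : p < 11) (hq : q < 11)
    (hA9 : ∀ v, A v → v < 9)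
    (hA : ∀ e ∈ L, (A e.1 → ¬ A e.2 → e.1 = p ∧ e.2 = q) ∧ (A e.2 → ¬ A e.1 → e.2 = p ∧ e.1 = q))
    (par : ℕ → ℕ) (hpar : ∀ v, v < 11 → par v < 11) (x1 y1 x2 y2 x3 y3 : ℕ)
    (hx1 : x1 < 11) (hy1 : y1 < 11) (hx2 : x2 < 11) (hy2 : y2 < 11) (hx3 : x3 < 11)
    (hy3 : y3 < 11)
    (hS : ∀ e ∈ L, e.2 = par e.1 ∨ e = (x1, y1) ∨ e = (x2, y2) ∨ e = (x3, y3))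
    (h1 : (A x1 ∧ A x2 ∧ ¬ A x3) ∨ (A x1 ∧ ¬ A x2 ∧ ¬ A x3)) :
    (net k e L).IsLevel 2 := by
  classical
  intro H hH
  change (gr L k).Subgraph at H
  have hside := one_side (net k e L) H hH.1 {v : Fin (12 + 2 * k) | A v.val}
    (⟨p, by omega⟩ : Fin (12 + 2 * k)) (⟨q, by omega⟩ : Fin (12 + 2 * k)) (by
      intro u v huv hu hv
      change Fin (12 + 2 * k) at u v
      change (gr L k).Adj u v at huv
      change A u.val at hu
      change ¬ A v.val at hv
      have hu9 := hA9 _ hu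
      rw [gr_adj hL, core_R hL (by omega)] at huv
      have : u.val = p ∧ v.val = q := by
        rcases huv with (h | h) | h
        · exact (hA _ h).1 hu hv
        · exact (hA _ h).2 hu hv
        · omega
      exact ⟨Fin.ext this.1, Fin.ext this.2⟩)
  have hne : H.verts.Nonempty := by
    rw [Set.nonempty_iff_ne_empty]
    intro h
    have := hH.1.1
    change 3 ≤ H.verts.ncard at this
    simp [h] at this
  let P : Fin (12 + 2 * k) → Fin (12 + 2 * k) := fun v =>
    ⟨if v.val < 11 then par v.val else if v.val % 2 = 0 then v.val - 1 else v.val - 2, by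
      have := v.2
      split_ifs with h
      · have := hpar _ h; omega
      · omega
      · omega⟩
  have hcore : ∀ u v : Fin (12 + 2 * k), H.Adj u v → v < u → v = P u ∨
      (u.val = x1 ∧ v.val = y1) ∨ (u.val = x2 ∧ v.val = y2) ∨ (u.val = x3 ∧ v.val = y3) := by
    intro u v huv hlt
    have hadj := (gr_adj hL).1 huv.adj_sub
    have hR : R L u v := by
      rcases hadj with h | h
      · exact h
      · have := R_lt hL h
        rw [Fin.lt_def] at hlt
        omega
    rcases hR with h | h | h
    · have h11 := (hL _ h).2
      rcases hS _ h with h' | h' | h' | h'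
      · left
        apply Fin.ext
        simp only [P]
        simp at h11
        rw [if_pos h11]
        exact h'
      all_goals simp only [Prod.mk.injEq] at h'; tauto
    · left
      apply Fin.ext
      simp only [P]
      split_ifs <;> omega
    · left
      apply Fin.ext
      simp only [P]
      split_ifs <;> omega
  have fin : ∀ i j i' j' : ℕ, i < 11 → j < 11 → i' < 11 → j' < 11 →
      (∀ u v : Fin (12 + 2 * k), H.Adj u v → v < u → v = P u ∨
      (u.val = i ∧ v.val = j) ∨ (u.val = i' ∧ v.val = j')) →
      H.edgeSet.ncard + 1 ≤ H.verts.ncard + 2 := by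
    intro i j i' j' hi hj hi' hj' hh
    have := edge_count (gr L k) H hne P
      {s(⟨i, by omega⟩, ⟨j, by omega⟩), s(⟨i', by omega⟩, ⟨j', by omega⟩)} (by
        intro u v huv hlt
        rcases hh u v huv hlt with h | h | h
        · exact Or.inl h
        · right
          have hu : u = ⟨i, by omega⟩ := Fin.ext h.1
          have hv : v = ⟨j, by omega⟩ := Fin.ext h.2
          simp [hu, hv]
        · right
          have hu : u = ⟨i', by omega⟩ := Fin.ext h.1
          have hv : v = ⟨j', by omega⟩ := Fin.ext h.2
          simp [hu, hv])
    refine this.trans ?_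
    have := Finset.card_le_two (a := (s(⟨i, by omega⟩, ⟨j, by omega⟩) : Sym2 (Fin (12 + 2 * k))))
      (b := s(⟨i', by omega⟩, ⟨j', by omega⟩))
    omega
  change H.edgeSet.ncard + 1 ≤ H.verts.ncard + 2
  change (∀ v ∈ H.verts, A v.val) ∨ (∀ v ∈ H.verts, ¬ A v.val) at hside
  rcases hside with hs | hs
  · refine fin x1 y1 x2 y2 hx1 hy1 hx2 hy2 fun u v huv hlt => ?_
    have hu := hs u huv.fst_mem
    rcases hcore u v huv hlt with h | h | h | h
    · exact Or.inl h
    · exact Or.inr (Or.inl h)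
    · exact Or.inr (Or.inr h)
    · rw [h.1] at hu; tauto
  · refine fin x2 y2 x3 y3 hx2 hy2 hx3 hy3 fun u v huv hlt => ?_
    have hu := hs u huv.fst_mem
    rcases hcore u v huv hlt with h | h | h | h
    · exact Or.inl h
    · rw [h.1] at hu; tauto
    · exact Or.inr (Or.inl h)
    · exact Or.inr (Or.inr h)

/-- A distance table for the core, with target `t`. -/
def Tab (L : List (ℕ × ℕ)) (t : ℕ) (tab : ℕ → ℕ) : Prop :=
  (∀ e ∈ L, tab e.1 ≤ tab e.2 + 1 ∧ tab e.2 ≤ tab e.1 + 1) ∧ tab t = 0 ∧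
  ∀ v < 11, v ≠ t → ∃ w < 11, ((v, w) ∈ L ∨ (w, v) ∈ L) ∧ tab w + 1 = tab v

/-- Distances to a core leaf. -/
lemma dist_core {L} (hL : Ok L) (k t : ℕ) (ht : t < 11) (tab : ℕ → ℕ) (hT : Tab L t tab)
    (v : Fin (12 + 2 * k)) : (gr L k).dist v ⟨t, by omega⟩ =
      if v.val < 11 then tab v.val else tab 9 + (v.val - 8) / 2 := by
  obtain ⟨hl, h0, hd⟩ := hT
  refine dist_of_cert (gr L k) ⟨t, by omega⟩
    (fun v => if v.val < 11 then tab v.val else tab 9 + (v.val - 8) / 2) ?_ ?_ ?_ v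
  · simp [ht, h0]
  · intro u v huv
    rw [gr_adj hL] at huv
    by_cases hu : u.val < 11
    · rw [core_R hL hu] at huv
      rcases huv with h | h
      · have hv := mem_lt hL h
        simp only [hu, hv, if_true]
        rcases h with h | h
        · exact (hl _ h).1
        · exact (hl _ h).2
      · simp [h]; omega
    · rw [tail_R hL (by omega)] at huv
      by_cases hv : v.val < 11
      · have : v.val = 9 := by omega
        simp [hu, this]
        omega
      · simp only [hu, hv, if_false]
        omega
  · intro v hvt
    have hv2 := v.2
    by_cases hv : v.val < 11
    · obtain ⟨w, hw, h1, h2⟩ := hd v.val hv (fun h => hvt (Fin.ext h))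
      refine ⟨⟨w, by omega⟩, ?_, by simp [hw, hv, h2]⟩
      rw [gr_adj hL, core_R hL hv]
      exact Or.inl h1
    · by_cases hev : v.val % 2 = 0
      · refine ⟨⟨v.val - 1, by omega⟩, ?_, ?_⟩
        · rw [gr_adj hL, tail_R hL (by omega)]
          simp; omega
        · have : ¬ (v.val - 1 < 11) := by omega
          simp only [hv, this, if_false]; omega
      · refine ⟨⟨v.val - 2, by omega⟩, ?_, ?_⟩
        · rw [gr_adj hL, tail_R hL (by omega)]
          simp; omega
        · by_cases h : v.val = 11
          · simp [h]
          · have : ¬ (v.val - 2 < 11) := by omega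
            simp only [hv, this, if_false]; omega

/-- The distance function to a tail leaf `t`. -/
def tf (t : ℕ) (tab : ℕ → ℕ) (v : ℕ) : ℕ :=
  if v = t then 0 else
  if v < 11 then tab v + (t - 8) / 2
  else ((v - 11) / 2 - (t - 11) / 2) + ((t - 11) / 2 - (v - 11) / 2) + (1 - v % 2) + (1 - t % 2)

/-- Distances to a tail leaf. -/
lemma dist_tail {L} (hL : Ok L) (k : ℕ) (t : Fin (12 + 2 * k))
    (ht : t.val = 11 + 2 * k ∨ (12 ≤ t.val ∧ t.val % 2 = 0)) (tab : ℕ → ℕ) (hT : Tab L 9 tab)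
    (v : Fin (12 + 2 * k)) : (gr L k).dist v t = tf t.val tab v.val := by
  obtain ⟨hl, h0, hd⟩ := hT
  have ht2 := t.2
  refine dist_of_cert (gr L k) t (fun v => tf t.val tab v.val) ?_ ?_ ?_ v
  · simp [tf]
  · intro u v huv
    have hu2 := u.2
    have hv2 := v.2
    rw [gr_adj hL] at huv
    by_cases hu : u.val < 11
    · rw [core_R hL hu] at huv
      rcases huv with h | h
      · have hv := mem_lt hL h
        have h1 : u.val ≠ t.val := by omega
        have h2 : v.val ≠ t.val := by omega
        simp only [tf, hu, hv, h1, h2, if_true, if_false]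
        rcases h with h | h
        · have := (hl _ h).1; simp at this; omega
        · have := (hl _ h).2; simp at this; omega
      · simp only [tf, h, h0]
        split_ifs <;> omega
    · rw [tail_R hL (by omega)] at huv
      by_cases hv : v.val < 11
      · have : v.val = 9 := by omega
        simp only [tf, this, h0]
        split_ifs <;> omega
      · simp only [tf, hu, hv, if_false]
        split_ifs <;> omega
  · intro v hvt
    have hv2 := v.2
    have hvt' : v.val ≠ t.val := fun h => hvt (Fin.ext h)
    by_cases hv : v.val < 11
    · by_cases h9 : v.val = 9
      · refine ⟨⟨11, by omega⟩, ?_, ?_⟩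
        · rw [gr_adj hL, core_R hL hv]
          simp [h9]
        · simp only [tf, h9, h0]
          split_ifs <;> omega
      · obtain ⟨w, hw, h1, h2⟩ := hd v.val hv h9
        refine ⟨⟨w, by omega⟩, ?_, ?_⟩
        · rw [gr_adj hL, core_R hL hv]
          exact Or.inl h1
        · simp only [tf]
          split_ifs <;> omega
    · by_cases hev : v.val % 2 = 0
      · refine ⟨⟨v.val - 1, by omega⟩, ?_, ?_⟩
        · rw [gr_adj hL, tail_R hL (by omega)]
          simp; omega
        · simp only [tf]
          split_ifs <;> omega
      · by_cases hpos : (t.val - 11) / 2 < (v.val - 11) / 2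
        · refine ⟨⟨v.val - 2, by omega⟩, ?_, ?_⟩
          · rw [gr_adj hL, tail_R hL (by omega)]
            simp; omega
          · simp only [tf]
            split_ifs <;> omega
        · by_cases heq : (t.val - 11) / 2 = (v.val - 11) / 2
          · refine ⟨⟨v.val + 1, by omega⟩, ?_, ?_⟩
            · rw [gr_adj hL, tail_R hL (by omega)]
              simp; omega
            · simp only [tf]
              split_ifs <;> omega
          · refine ⟨⟨v.val + 2, by omega⟩, ?_, ?_⟩
            · rw [gr_adj hL, tail_R hL (by omega)]
              simp; omega
            · simp only [tf]
              split_ifs <;> omega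

/-! ### The two concrete cores -/

def L1 : List (ℕ × ℕ) :=
  [(1,0),(2,0),(2,1),(3,2),(4,3),(5,3),(5,4),(6,4),(9,5),(9,6),(7,0),(8,1),(10,6)]

def L2 : List (ℕ × ℕ) :=
  [(1,0),(3,0),(2,1),(3,2),(4,3),(4,2),(5,4),(6,5),(9,5),(9,6),(7,0),(8,1),(10,6)]

def nb1 (v : ℕ) : List ℕ :=
  [[1,2,7],[0,2,8],[0,1,3],[2,4,5],[3,5,6],[3,4,9],[4,9,10],[0],[1],[5,6],[6]].getD v []

def nb2 (v : ℕ) : List ℕ :=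
  [[1,3,7],[0,2,8],[1,3,4],[0,2,4],[2,3,5],[4,6,9],[5,9,10],[0],[1],[5,6],[6]].getD v []

lemma core1 : Core L1 nb1 := by
  constructor
  · unfold Ok; decide
  · decide
  · intro v hv w hw
    interval_cases v <;> interval_cases w <;> decide
  · decide
  · decide
  · decide
  · intro v hv h7 h8 h10
    interval_cases v <;> first | contradiction | decide

lemma core2 : Core L2 nb2 := by
  constructor
  · unfold Ok; decide
  · decide
  · intro v hv w hw
    interval_cases v <;> interval_cases w <;> decide
  · decide
  · decide
  · decide
  · intro v hv h7 h8 h10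
    interval_cases v <;> first | contradiction | decide

lemma level1 {X : Type} (k : ℕ) (e : X ≃ Fin (k + 4)) : (net k e L1).IsLevel 2 :=
  net_isLevel core1.ok k e (fun v => v ∈ [0,1,2,7,8]) 2 3 (by decide) (by decide)
    (by intro v hv; simp at hv; omega) (by decide)
    (fun v => [0,0,0,2,3,3,4,0,1,5,6].getD v 0) (by decide) 2 1 5 4 9 6
    (by decide) (by decide) (by decide) (by decide) (by decide) (by decide) (by decide) (by decide)

lemma level2 {X : Type} (k : ℕ) (e : X ≃ Fin (k + 4)) : (net k e L2).IsLevel 2 :=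
  net_isLevel core2.ok k e (fun v => v ∈ [0,1,2,3,4,7,8]) 4 5 (by decide) (by decide)
    (by intro v hv; simp at hv; omega) (by decide)
    (fun v => [0,0,1,0,3,4,5,0,1,5,6].getD v 0) (by decide) 3 2 4 2 9 6
    (by decide) (by decide) (by decide) (by decide) (by decide) (by decide) (by decide) (by decide)

def tb (l : List ℕ) (v : ℕ) : ℕ := l.getD v 0

lemma t17 : Tab L1 7 (tb [1,2,2,3,4,4,5,0,3,5,6]) := by unfold Tab; decide
lemma t18 : Tab L1 8 (tb [2,1,2,3,4,4,5,3,0,5,6]) := by unfold Tab; decide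
lemma t10 : Tab L1 10 (tb [5,5,4,3,2,3,1,6,6,2,0]) := by unfold Tab; decide
lemma t19 : Tab L1 9 (tb [4,4,3,2,2,1,1,5,5,0,2]) := by unfold Tab; decide
lemma t27 : Tab L2 7 (tb [1,2,3,2,3,4,5,0,3,5,6]) := by unfold Tab; decide
lemma t28 : Tab L2 8 (tb [2,1,2,3,3,4,5,3,0,5,6]) := by unfold Tab; decide
lemma t20 : Tab L2 10 (tb [5,5,4,4,3,2,1,6,6,2,0]) := by unfold Tab; decide
lemma t29 : Tab L2 9 (tb [4,4,3,3,2,1,1,5,5,0,2]) := by unfold Tab; decide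

lemma same_dist (k : ℕ) (i j : Fin (k + 4)) :
    (gr L1 k).dist (lf k i) (lf k j) = (gr L2 k).dist (lf k i) (lf k j) := by
  have hi := lf_cases k i
  have hj := lf_cases k j
  generalize lf k i = v at *
  generalize lf k j = t at *
  have core : ∀ (t0 : ℕ) (ht0 : t0 < 11) (l l' : List ℕ), t.val = t0 → Tab L1 t0 (tb l) →
      Tab L2 t0 (tb l') →
      (tb l 7 = tb l' 7 ∧ tb l 8 = tb l' 8 ∧ tb l 10 = tb l' 10 ∧ tb l 9 = tb l' 9) →
      (gr L1 k).dist v t = (gr L2 k).dist v t := by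
    intro t0 ht0 l l' htt h1 h2 ⟨h7, h8, h10, h9⟩
    have hte : t = ⟨t0, by omega⟩ := Fin.ext htt
    rw [hte, dist_core core1.ok k t0 ht0 _ h1, dist_core core2.ok k t0 ht0 _ h2]
    rcases hi with h | h | h | h | h
    · simp [h, h7]
    · simp [h, h8]
    · simp [h, h10]
    · have : ¬ v.val < 11 := by omega
      simp only [this, if_false, h9]
    · have : ¬ v.val < 11 := by omega
      simp only [this, if_false, h9]
  have tl : (t.val = 11 + 2 * k ∨ (12 ≤ t.val ∧ t.val % 2 = 0)) →
      (gr L1 k).dist v t = (gr L2 k).dist v t := by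
    intro ht
    rw [dist_tail core1.ok k t ht _ t19, dist_tail core2.ok k t ht _ t29]
    rcases hi with h | h | h | h | h
    · simp [tf, tb, h]
    · simp [tf, tb, h]
    · simp [tf, tb, h]
    · have : ¬ v.val < 11 := by omega
      simp only [tf, this, if_false]
    · have : ¬ v.val < 11 := by omega
      simp only [tf, this, if_false]
  rcases hj with h | h | h | h | h
  · exact core 7 (by omega) _ _ h t17 t27 (by decide)
  · exact core 8 (by omega) _ _ h t18 t28 (by decide)
  · exact core 10 (by omega) _ _ h t10 t20 (by decide)
  · exact tl (Or.inl h)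
  · exact tl (Or.inr h)

lemma not_iso {X : Type} (k : ℕ) (e : X ≃ Fin (k + 4)) :
    ¬ (net k e L1).IsomLabelled (net k e L2) := by
  rintro ⟨φ, hφ⟩
  change gr L1 k ≃g gr L2 k at φ
  have hφ' : ∀ j, φ (lf k j) = lf k j := by
    intro j
    have := hφ (e.symm j)
    change φ (lf k (e (e.symm j))) = lf k (e (e.symm j)) at this
    rwa [e.apply_symm_apply] at this
  have a1 : ∀ u v : ℕ, ∀ hu : u < 11, ∀ hv : v < 11, v ∈ nb1 u →
      (gr L1 k).Adj ⟨u, by omega⟩ ⟨v, by omega⟩ := by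
    intro u v hu hv h
    rw [gr_adj core1.ok, core_R core1.ok hu]
    exact Or.inl ((core1.nbs u hu v hv).2 h)
  have b2 : ∀ u v : Fin (12 + 2 * k), u.val < 9 → (gr L2 k).Adj u v → v.val ∈ nb2 u.val := by
    intro u v hu h
    rw [gr_adj core2.ok, core_R core2.ok (by omega)] at h
    rcases h with h | h
    · exact (core2.nbs _ (by omega) _ (mem_lt core2.ok h)).1 h
    · omega
  have h7 : φ ⟨7, by omega⟩ = ⟨7, by omega⟩ := by
    have := hφ' ⟨0, by omega⟩; simpa [lf] using this
  have h8 : φ ⟨8, by omega⟩ = ⟨8, by omega⟩ := by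
    have := hφ' ⟨1, by omega⟩; simpa [lf] using this
  have e70 := φ.map_adj_iff.2 (a1 7 0 (by omega) (by omega) (by decide))
  have e81 := φ.map_adj_iff.2 (a1 8 1 (by omega) (by omega) (by decide))
  have e02 := φ.map_adj_iff.2 (a1 0 2 (by omega) (by omega) (by decide))
  have e12 := φ.map_adj_iff.2 (a1 1 2 (by omega) (by omega) (by decide))
  rw [h7] at e70
  rw [h8] at e81
  have h0 := b2 _ _ (by simp) e70
  have h1 := b2 _ _ (by simp) e81
  replace h0 : (φ ⟨0, by omega⟩).val = 0 := List.mem_singleton.1 h0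
  replace h1 : (φ ⟨1, by omega⟩).val = 1 := List.mem_singleton.1 h1
  have h2 := b2 _ _ (by rw [h0]; simp) e02
  have h3 := b2 _ _ (by rw [h1]; simp) e12
  rw [h0] at h2
  rw [h1] at h3
  generalize (φ ⟨2, by omega⟩).val = z at h2 h3
  simp [nb2] at h2 h3
  omega

end Aux


/-- Lemma 1: For every `n ≥ 4` there exist two distinct (non-isomorphic) level-2
phylogenetic networks on the same set `X` of `n` leaves with the same shortest
distance matrix. -/
theorem level2_not_reconstructible_from_shortest_distances
    (n : ℕ) (hn : 4 ≤ n) (X : Type) [Fintype X] [DecidableEq X]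
    (hX : Fintype.card X = n) :
    ∃ N N' : LabGraph X, N.IsNetwork ∧ N'.IsNetwork ∧
      N.IsLevel 2 ∧ N'.IsLevel 2 ∧
      (∀ x y : X, N.dm x y = N'.dm x y) ∧
      ¬ N.IsomLabelled N' := by
  obtain ⟨k, rfl⟩ : ∃ k, n = k + 4 := ⟨n - 4, by omega⟩
  let e : X ≃ Fin (k + 4) := Fintype.equivFinOfCardEq hX
  exact ⟨Aux.net k e Aux.L1, Aux.net k e Aux.L2, Aux.net_isNetwork Aux.core1 k e,
    Aux.net_isNetwork Aux.core2 k e, Aux.level1 k e, Aux.level2 k e,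
    fun x y => Aux.same_dist k (e x) (e y), Aux.not_iso k e⟩

end LabGraph
end

section
/- For every integer k ≥ 3 and every finite set X with |X| ≥ 2, there exist two non-isomorphic level-k phylogenetic networks on X such that d^{N}(x,y) = d^{N'}(x,y) for all leaves x, y ∈ X, i.e., the two networks have the same multisets of distances between every pair of leaves (and consequently also the same shortest distance matrix). -/
open SimpleGraph

namespace LabGraph

variable {X : Type} [Fintype X] [DecidableEq X]

set_option linter.unusedSectionVars false


section glue
variable {W U : Type}

def glueAdj (B : SimpleGraph W) (w0 : W) (T : SimpleGraph U) (u0 : U) : W ⊕ U → W ⊕ U → Prop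
  | Sum.inl a, Sum.inl b => B.Adj a b
  | Sum.inr a, Sum.inr b => T.Adj a b
  | Sum.inl a, Sum.inr b => a = w0 ∧ b = u0
  | Sum.inr b, Sum.inl a => a = w0 ∧ b = u0

/-- Disjoint union of `B` and `T` plus one edge `w0 - u0`. -/
def glue (B : SimpleGraph W) (w0 : W) (T : SimpleGraph U) (u0 : U) : SimpleGraph (W ⊕ U) where
  Adj := glueAdj B w0 T u0
  symm := ⟨by
    rintro (a | a) (b | b) h <;> simp only [glueAdj] at h ⊢
    · exact h.symm
    · exact h
    · exact h
    · exact h.symm⟩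
  loopless := ⟨by rintro (a | a) h <;> simp [glueAdj] at h⟩

variable (B : SimpleGraph W) (w0 : W) (T : SimpleGraph U) (u0 : U)

@[simp] lemma glue_ll (a b : W) : (glue B w0 T u0).Adj (Sum.inl a) (Sum.inl b) ↔ B.Adj a b := Iff.rfl
@[simp] lemma glue_rr (a b : U) : (glue B w0 T u0).Adj (Sum.inr a) (Sum.inr b) ↔ T.Adj a b := Iff.rfl
@[simp] lemma glue_lr (a : W) (b : U) :
    (glue B w0 T u0).Adj (Sum.inl a) (Sum.inr b) ↔ a = w0 ∧ b = u0 := Iff.rfl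
@[simp] lemma glue_rl (a : W) (b : U) :
    (glue B w0 T u0).Adj (Sum.inr b) (Sum.inl a) ↔ a = w0 ∧ b = u0 := Iff.rfl

def inlHom : B →g glue B w0 T u0 where
  toFun := Sum.inl
  map_rel' := fun h => h

def inrHom : T →g glue B w0 T u0 where
  toFun := Sum.inr
  map_rel' := fun h => h

lemma glue_connected (hB : B.Connected) (hT : T.Connected) : (glue B w0 T u0).Connected := by
  have key : ∀ v, (glue B w0 T u0).Reachable v (Sum.inl w0) := by
    rintro (a | a)
    · exact (hB.preconnected a w0).map (inlHom B w0 T u0)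
    · refine ((hT.preconnected a u0).map (inrHom B w0 T u0)).trans ?_
      exact SimpleGraph.Adj.reachable (show (glue B w0 T u0).Adj (Sum.inr u0) (Sum.inl w0) by simp)
  have : Nonempty (W ⊕ U) := ⟨Sum.inl w0⟩
  exact ⟨fun a b => (key a).trans (key b).symm⟩

lemma mem_support_of_inr {a b : W ⊕ U} (p : (glue B w0 T u0).Walk a b) :
    (∃ u, a = Sum.inr u) → (∃ y, b = Sum.inl y) → Sum.inl w0 ∈ p.support := by
  induction p with
  | nil => rintro ⟨u, rfl⟩ ⟨y, h⟩; cases h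
  | @cons a c b h p ih =>
    rintro ⟨u, rfl⟩ hb
    rcases c with c | c
    · have : c = w0 := h.1
      subst this
      simp
    · simp only [Walk.support_cons, List.mem_cons]
      exact Or.inr (ih ⟨c, rfl⟩ hb)

lemma lift_path {a b : W ⊕ U} (p : (glue B w0 T u0).Walk a b) :
    p.IsPath → ∀ x y, (ha : a = Sum.inl x) → (hb : b = Sum.inl y) →
      ∃ q : B.Walk x y, q.map (inlHom B w0 T u0) = p.copy ha hb := by
  induction p with
  | nil =>
    rintro - x y rfl h
    cases h
    exact ⟨Walk.nil, rfl⟩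
  | @cons a c b h p ih =>
    rintro hp x y rfl rfl
    rw [Walk.cons_isPath_iff] at hp
    rcases c with c | c
    · obtain ⟨q, hq⟩ := ih hp.1 c y rfl rfl
      refine ⟨Walk.cons h q, ?_⟩
      simp only [Walk.copy_rfl_rfl] at hq ⊢
      rw [← hq]
      rfl
    · exfalso
      have hx : x = w0 := h.1
      subst hx
      exact hp.2 (mem_support_of_inr _ _ _ _ p ⟨c, rfl⟩ ⟨y, rfl⟩)

lemma inl_inj : Function.Injective (inlHom B w0 T u0) := fun _ _ h => Sum.inl_injective h

noncomputable def pathEquiv (x y : W) :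
    B.Path x y ≃ (glue B w0 T u0).Path (Sum.inl x) (Sum.inl y) :=
  Equiv.ofBijective
    (fun p => (⟨p.1.map (inlHom B w0 T u0), p.2.map (inl_inj B w0 T u0)⟩ :
      (glue B w0 T u0).Path (Sum.inl x) (Sum.inl y))) (by
    constructor
    · intro p q h
      have := congrArg Subtype.val h
      exact Subtype.ext (Walk.map_injective_of_injective (inl_inj B w0 T u0) _ _ this)
    · rintro ⟨p, hp⟩
      obtain ⟨q, hq⟩ := lift_path B w0 T u0 p hp x y rfl rfl
      simp only [Walk.copy_rfl_rfl] at hq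
      refine ⟨⟨q, ?_⟩, Subtype.ext hq⟩
      rw [← hq] at hp
      exact hp.of_map)

lemma pathEquiv_length (x y : W) (p : B.Path x y) :
    (pathEquiv B w0 T u0 x y p).1.length = p.1.length := by
  exact Walk.length_map _ _

end glue

section dms

lemma map_univ_equiv {α β : Type} {_ : Fintype α} {_ : Fintype β} (e : α ≃ β) (f : α → ℕ) (g : β → ℕ)
    (h : ∀ a, g (e a) = f a) :
    (Finset.univ : Finset α).val.map f = (Finset.univ : Finset β).val.map g := by
  have h1 : (Finset.univ : Finset β) = (Finset.univ : Finset α).map e.toEmbedding := by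
    simp
  rw [h1, Finset.map_val, Multiset.map_map]
  exact Multiset.map_congr rfl (fun p _ => (h p).symm)

variable {W U U' : Type} [Fintype W] [Fintype U] [Fintype U']

def gl (B : SimpleGraph W) (w0 : W) (l : X → W) (T : SimpleGraph U) (u0 : U) : LabGraph X where
  V := W ⊕ U
  G := glue B w0 T u0
  leaf := fun x => Sum.inl (l x)

lemma dms_gl (B : SimpleGraph W) (w0 : W) (l : X → W) (T : SimpleGraph U) (u0 : U)
    (T' : SimpleGraph U') (u0' : U') (x y : X) :
    (gl B w0 l T u0).dms x y = (gl B w0 l T' u0').dms x y := by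
  classical
  unfold dms
  let e : (glue B w0 T u0).Path (Sum.inl (l x)) (Sum.inl (l y)) ≃
    (glue B w0 T' u0').Path (Sum.inl (l x)) (Sum.inl (l y)) :=
    (pathEquiv B w0 T u0 (l x) (l y)).symm.trans (pathEquiv B w0 T' u0' (l x) (l y))
  have he : ∀ p, (e p).1.length = p.1.length := by
    intro p
    simp only [e, Equiv.trans_apply, pathEquiv_length]
    conv_rhs => rw [← (pathEquiv B w0 T u0 (l x) (l y)).apply_symm_apply p]
    rw [pathEquiv_length]
  exact map_univ_equiv e (fun p => p.1.length) (fun p => p.1.length) he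

end dms

section level

/-- A connected subgraph meeting both `A` and its complement has a crossing edge. -/
lemma crossing {V : Type} {G : SimpleGraph V} (H : G.Subgraph) (hH : H.coe.Connected) (A : Set V)
    {x y : V} (hx : x ∈ H.verts) (hy : y ∈ H.verts) (hxA : x ∈ A) (hyA : y ∉ A) :
    ∃ u v, H.Adj u v ∧ u ∈ A ∧ v ∉ A := by
  obtain ⟨p⟩ := hH.preconnected ⟨x, hx⟩ ⟨y, hy⟩
  obtain ⟨d, -, h1, h2⟩ := p.exists_boundary_dart {z | z.1 ∈ A} hxA hyA
  exact ⟨_, _, d.adj, h1, h2⟩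

lemma twoConn_side (N : LabGraph X) (H : N.G.Subgraph) (hH : N.TwoConnSub H) (A : Set N.V)
    (a b : N.V) (hAB : ∀ u v, N.G.Adj u v → u ∈ A → v ∉ A → u = a ∧ v = b) 
    {x : N.V} (hx : x ∈ H.verts) (hxA : x ∈ A) : H.verts ⊆ A := by
  intro y hy
  by_contra hyA
  obtain ⟨h3, hc, hd⟩ := hH
  obtain ⟨u, v, huv, hu, hv⟩ := crossing H hc A hx hy hxA hyA
  obtain ⟨rfl, rfl⟩ := hAB u v huv.adj_sub hu hv
  have huH := huv.fst_mem
  have hvH := huv.snd_mem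
  have : ∃ w ∈ H.verts, w ≠ u ∧ w ≠ v := by
    by_contra hcon
    push Not at hcon
    have hs : H.verts ⊆ {u, v} := by
      intro w hw
      by_cases h : w = u
      · simp [h]
      · simp [hcon w hw h]
    have := Set.ncard_le_ncard hs (Set.toFinite _)
    have := Set.ncard_insert_le u {v}
    have := Set.ncard_singleton v
    omega
  obtain ⟨w, hw, hwu, hwv⟩ := this
  by_cases hwA : w ∈ A
  · obtain ⟨u', v', h', hu', hv'⟩ := crossing (H.deleteVerts {u}) (hd u huH) A
      (x := w) (y := v) (by simp [hw, hwu]) (by simp [hvH]; rintro rfl; exact hv hu) hwA hv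
    obtain ⟨rfl, rfl⟩ := hAB _ _ h'.adj_sub hu' hv'
    have := h'.fst_mem
    simp at this
  · obtain ⟨u', v', h', hu', hv'⟩ := crossing (H.deleteVerts {v}) (hd v hvH) A
      (x := u) (y := w) (by simp [huH]; rintro rfl; exact hv hu) (by simp [hw, hwv]) hu hwA
    obtain ⟨rfl, rfl⟩ := hAB _ _ h'.adj_sub hu' hv'
    have := h'.snd_mem
    simp at this

lemma level_of_small (N : LabGraph X) (H : N.G.Subgraph) (hd : ∀ v, N.degOf v ≤ 3)
    (h3 : 3 ≤ H.verts.ncard) (h5 : H.verts.ncard ≤ 5) :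
    H.edgeSet.ncard + 1 ≤ H.verts.ncard + 3 := by
  classical
  have : Fintype H.verts := Fintype.ofFinite _
  have h1 := H.coe.sum_degrees_eq_twice_card_edges
  have h2 : ∀ v : H.verts, H.coe.degree v ≤ 3 := by
    intro v
    refine le_trans ?_ (hd v)
    rw [← SimpleGraph.card_neighborSet_eq_degree, ← Nat.card_eq_fintype_card]
    rw [degOf, ← Nat.card_coe_set_eq]
    refine Nat.card_le_card_of_injective
      (fun w : H.coe.neighborSet v => (⟨w.1.1, H.adj_sub w.2⟩ : N.G.neighborSet v)) ?_
    intro p q h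
    have := congrArg Subtype.val h
    exact Subtype.ext (Subtype.ext this)
  have h4 : 2 * H.coe.edgeFinset.card ≤ (Finset.univ : Finset H.verts).card • 3 := by
    rw [← h1]
    refine Finset.sum_le_card_nsmul _ _ 3 (fun v _ => ?_)
    exact le_of_eq_of_le (by congr!) (h2 v)
  have h6 : (Finset.univ : Finset H.verts).card = H.verts.ncard := by
    rw [← Nat.card_coe_set_eq, Nat.card_eq_fintype_card]; rfl
  have h7 : H.edgeSet.ncard = H.coe.edgeFinset.card := by
    rw [← H.image_coe_edgeSet_coe, Set.ncard_image_of_injective]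
    · rw [← SimpleGraph.coe_edgeFinset, Set.ncard_coe_finset]
    · exact Sym2.map.injective Subtype.val_injective
  rw [h6, smul_eq_mul] at h4
  omega

end level

section cat

/-- The base caterpillar: leaves `inl i`, spine vertices `inr j`. -/
def catAdj (m : ℕ) : Fin (m + 2) ⊕ Fin (m + 1) → Fin (m + 2) ⊕ Fin (m + 1) → Prop
  | Sum.inl _, Sum.inl _ => False
  | Sum.inl i, Sum.inr j => j.1 = min i.1 m
  | Sum.inr j, Sum.inl i => j.1 = min i.1 m
  | Sum.inr i, Sum.inr j => i.1 + 1 = j.1 ∨ j.1 + 1 = i.1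

def cat (m : ℕ) : SimpleGraph (Fin (m + 2) ⊕ Fin (m + 1)) where
  Adj := catAdj m
  symm := ⟨by
    rintro (a | a) (b | b) h <;> simp only [catAdj] at h ⊢
    · exact h
    · exact h
    · exact h.symm⟩
  loopless := ⟨by rintro (a | a) h <;> simp [catAdj] at h⟩

@[simp] lemma cat_ll (m : ℕ) (i j) : (cat m).Adj (Sum.inl i) (Sum.inl j) ↔ False := Iff.rfl
@[simp] lemma cat_lr (m : ℕ) (i j) : (cat m).Adj (Sum.inl i) (Sum.inr j) ↔ j.1 = min i.1 m := Iff.rfl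
@[simp] lemma cat_rl (m : ℕ) (i j) : (cat m).Adj (Sum.inr j) (Sum.inl i) ↔ j.1 = min i.1 m := Iff.rfl
@[simp] lemma cat_rr (m : ℕ) (i j) :
    (cat m).Adj (Sum.inr i) (Sum.inr j) ↔ (i.1 + 1 = j.1 ∨ j.1 + 1 = i.1) := Iff.rfl

lemma cat_connected (m : ℕ) : (cat m).Connected := by
  have h1 : ∀ (n : ℕ) (hn : n < m + 1), (cat m).Reachable (Sum.inr ⟨n, hn⟩) (Sum.inr 0) := by
    intro n
    induction n with
    | zero => intro hn; exact Reachable.refl _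
    | succ n ih =>
      intro hn
      have : (cat m).Adj (Sum.inr ⟨n + 1, hn⟩) (Sum.inr ⟨n, by omega⟩) := by simp
      exact this.reachable.trans (ih (by omega))
  have h2 : ∀ v, (cat m).Reachable v (Sum.inr 0) := by
    rintro (i | j)
    · have : (cat m).Adj (Sum.inl i) (Sum.inr ⟨min i.1 m, by omega⟩) := by simp
      exact this.reachable.trans (h1 _ _)
    · exact h1 j.1 j.2
  have : Nonempty (Fin (m + 2) ⊕ Fin (m + 1)) := ⟨Sum.inr 0⟩
  exact ⟨fun a b => (h2 a).trans (h2 b).symm⟩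

/-- Conditions on the leafless gadget. -/
structure Gadget {U : Type} [Fintype U] (T : SimpleGraph U) (u0 : U) : Prop where
  conn : T.Connected
  deg0 : (T.neighborSet u0).ncard = 2
  deg : ∀ u, u ≠ u0 → (T.neighborSet u).ncard = 3
  split : ∃ A : Set U, A.ncard ≤ 5 ∧ Aᶜ.ncard ≤ 5 ∧ u0 ∉ A ∧
    ∃ a b, ∀ u v, T.Adj u v → u ∈ A → v ∉ A → u = a ∧ v = b

variable {U : Type} [Fintype U]

/-- The network. -/
def net (m : ℕ) (e : X ≃ Fin (m + 2)) (T : SimpleGraph U) (u0 : U) : LabGraph X :=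
  gl (cat m) (Sum.inr 0) (fun x => Sum.inl (e x)) T u0

variable (m : ℕ) (e : X ≃ Fin (m + 2)) (T : SimpleGraph U) (u0 : U)

lemma deg_leaf (i : Fin (m + 2)) :
    ((glue (cat m) (Sum.inr 0) T u0).neighborSet (Sum.inl (Sum.inl i))).ncard = 1 := by
  rw [Set.ncard_eq_one]
  refine ⟨Sum.inl (Sum.inr ⟨min i.1 m, by omega⟩), ?_⟩
  ext v
  rcases v with (v | v) | v <;> simp [Fin.ext_iff]

lemma deg_spine (i : Fin (m + 1)) :
    ((glue (cat m) (Sum.inr 0) T u0).neighborSet (Sum.inl (Sum.inr i))).ncard = 3 := by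
  rw [Set.ncard_eq_three]
  refine ⟨Sum.inl (Sum.inl ⟨i.1, by omega⟩),
    if h : i.1 = 0 then Sum.inr u0 else Sum.inl (Sum.inr ⟨i.1 - 1, by omega⟩),
    if h : i.1 = m then Sum.inl (Sum.inl ⟨m + 1, by omega⟩) else Sum.inl (Sum.inr ⟨i.1 + 1, by omega⟩),
    ?_, ?_, ?_, ?_⟩
  · split_ifs <;> simp
  · split_ifs <;> simp <;> omega
  · split_ifs <;> simp [Fin.ext_iff, -Fin.val_eq_zero_iff, -Fin.val_fin_le, -Fin.val_fin_lt] <;> omega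
  · have := i.2
    ext v
    rcases v with (v | v) | v <;> split_ifs <;> simp [Fin.ext_iff, -Fin.val_eq_zero_iff, -Fin.val_fin_le, -Fin.val_fin_lt] <;> omega

lemma deg_gadget (hT : Gadget T u0) (u : U) :
    ((glue (cat m) (Sum.inr 0) T u0).neighborSet (Sum.inr u)).ncard = 3 := by
  by_cases h : u = u0
  · subst h
    have : (glue (cat m) (Sum.inr 0) T u).neighborSet (Sum.inr u) =
        insert (Sum.inl (Sum.inr 0)) (Sum.inr '' T.neighborSet u) := by
      ext v
      rcases v with v | v <;> simp
    rw [this, Set.ncard_insert_of_notMem (by simp), Set.ncard_image_of_injective _ Sum.inr_injective,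
      hT.deg0]
  · have : (glue (cat m) (Sum.inr 0) T u0).neighborSet (Sum.inr u) = Sum.inr '' T.neighborSet u := by
      ext v
      rcases v with v | v <;> simp [h]
    rw [this, Set.ncard_image_of_injective _ Sum.inr_injective, hT.deg u h]

lemma net_isNetwork (hT : Gadget T u0) : (net m e T u0).IsNetwork := by
  refine ⟨glue_connected _ _ _ _ (cat_connected m) hT.conn, ?_, Or.inr ⟨?_, ?_⟩⟩
  · intro x y h
    exact e.injective (Sum.inl_injective (Sum.inl_injective h))
  · intro x
    exact deg_leaf m T u0 (e x)
  · rintro ((v | v) | v) hv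
    · exact absurd ⟨e.symm v, by simp [net, gl]⟩ hv
    · exact deg_spine m T u0 v
    · exact deg_gadget m T u0 hT v

lemma net_deg_le (hT : Gadget T u0) (v : (net m e T u0).V) : (net m e T u0).degOf v ≤ 3 := by
  rcases v with (v | v) | v
  · exact (deg_leaf m T u0 v).le.trans (by norm_num)
  · exact (deg_spine m T u0 v).le
  · exact (deg_gadget m T u0 hT v).le

/-- Descendants of spine vertex `j`. -/
def below (j : ℕ) : Set ((Fin (m + 2) ⊕ Fin (m + 1)) ⊕ U) :=
  {v | match v with
    | Sum.inl (Sum.inl i) => j ≤ i.1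
    | Sum.inl (Sum.inr i) => j ≤ i.1
    | Sum.inr _ => False}

lemma net_blob_small (hT : Gadget T u0) (H : (net m e T u0).G.Subgraph)
    (hH : (net m e T u0).TwoConnSub H) : H.verts.ncard ≤ 5 := by
  have h3 := hH.1
  have hcut : ∀ (A : Set ((Fin (m + 2) ⊕ Fin (m + 1)) ⊕ U)) (a b : (Fin (m + 2) ⊕ Fin (m + 1)) ⊕ U),
      (∀ u v, (glue (cat m) (Sum.inr 0) T u0).Adj u v → u ∈ A → v ∉ A → u = a ∧ v = b) →
      ∀ x, x ∈ H.verts → x ∈ A → H.verts ⊆ A :=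
    fun A a b h x hx hxA => twoConn_side _ H hH A a b h hx hxA
  have hleaf : ∀ i, (Sum.inl (Sum.inl i) : (Fin (m + 2) ⊕ Fin (m + 1)) ⊕ U) ∉ H.verts := by
    intro i hi
    have hs := hcut {Sum.inl (Sum.inl i)} (Sum.inl (Sum.inl i))
      (Sum.inl (Sum.inr ⟨min i.1 m, by omega⟩)) (by
        rintro u ((v | v) | v) h hu - <;> rw [Set.mem_singleton_iff] at hu <;> subst hu <;>
          simp [Fin.ext_iff] at h ⊢
        exact h) _ hi rfl
    have h1 := Set.ncard_le_ncard hs (Set.toFinite _)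
    have h2 := Set.ncard_singleton (Sum.inl (Sum.inl i) : (Fin (m + 2) ⊕ Fin (m + 1)) ⊕ U)
    exact absurd (h3.trans (h1.trans h2.le)) (by norm_num)
  have hspine : ∀ i, (Sum.inl (Sum.inr i) : (Fin (m + 2) ⊕ Fin (m + 1)) ⊕ U) ∉ H.verts := by
    intro i hi
    have hi2 := i.2
    have hs := hcut (below m i.1) (Sum.inl (Sum.inr i))
      (if h : i.1 = 0 then Sum.inr u0 else Sum.inl (Sum.inr ⟨i.1 - 1, by omega⟩)) (by
        rintro ((u | u) | u) ((v | v) | v) h hu hv <;> simp [below, Fin.ext_iff, -Fin.val_eq_zero_iff, -Fin.val_fin_le, -Fin.val_fin_lt] at h hu hv ⊢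
        all_goals first | omega | (split_ifs <;> simp [Fin.ext_iff, -Fin.val_eq_zero_iff, -Fin.val_fin_le, -Fin.val_fin_lt] at h ⊢ <;> first | omega | exact ⟨by omega, h.2⟩)) _ hi (le_refl i.1)
    have hsub : H.verts ⊆ {Sum.inl (Sum.inr i)} := by
      rintro ((v | v) | v) hv
      · exact absurd hv (hleaf v)
      · by_cases hvi : v = i
        · subst hvi; rfl
        · exfalso
          have h1 : i.1 ≤ v.1 := hs hv
          have h2 : v.1 ≠ i.1 := fun h => hvi (Fin.ext h)
          have hv2 := v.2
          have hs' := hcut (below m (i.1 + 1)) (Sum.inl (Sum.inr ⟨i.1 + 1, by omega⟩))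
            (Sum.inl (Sum.inr i)) (by
              rintro ((u | u) | u) ((v | v) | v) h hu hv <;> simp [below, Fin.ext_iff, -Fin.val_eq_zero_iff, -Fin.val_fin_le, -Fin.val_fin_lt] at h hu hv ⊢
              all_goals omega) _ hv
              (show i.1 + 1 ≤ v.1 by omega) hi
          have : i.1 + 1 ≤ i.1 := hs'
          omega
      · exact (hs hv).elim
    have h1 := Set.ncard_le_ncard hsub (Set.toFinite _)
    have h2 := Set.ncard_singleton (Sum.inl (Sum.inr i) : (Fin (m + 2) ⊕ Fin (m + 1)) ⊕ U)
    exact absurd (h3.trans (h1.trans h2.le)) (by norm_num)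
  obtain ⟨A, hA, hA', h0, a, b, hab⟩ := hT.split
  have fin : ∀ C : Set U, C.ncard ≤ 5 →
      H.verts ⊆ (Sum.inr '' C : Set ((Fin (m + 2) ⊕ Fin (m + 1)) ⊕ U)) → H.verts.ncard ≤ 5 := by
    intro C hC hs
    have h1 := Set.ncard_le_ncard hs (Set.toFinite _)
    exact h1.trans ((Set.ncard_image_of_injective C Sum.inr_injective).le.trans hC)
  by_cases hex : ∃ u ∈ A, (Sum.inr u : (Fin (m + 2) ⊕ Fin (m + 1)) ⊕ U) ∈ H.verts
  · obtain ⟨u, huA, hu⟩ := hex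
    refine fin A hA (hcut _ (Sum.inr a) (Sum.inr b) ?_ _ hu ⟨u, huA, rfl⟩)
    rintro u v huv ⟨u', hu', rfl⟩ hv
    rcases v with v | v
    · have : u' = u0 := huv.2
      subst this
      exact absurd hu' h0
    · obtain ⟨rfl, rfl⟩ := hab u' v huv hu' (fun h => hv ⟨v, h, rfl⟩)
      exact ⟨rfl, rfl⟩
  · push Not at hex
    refine fin Aᶜ hA' ?_
    rintro ((v | v) | v) hv
    · exact absurd hv (hleaf v)
    · exact absurd hv (hspine v)
    · exact ⟨v, fun h => hex v h hv, rfl⟩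

lemma net_isLevel (hT : Gadget T u0) (k : ℕ) (hk : 3 ≤ k) : (net m e T u0).IsLevel k := by
  intro H hH
  have := level_of_small _ H (net_deg_le m e T u0 hT) hH.1.1 (net_blob_small m e T u0 hT H hH.1)
  omega

end cat

section gadgets

/-- The edge relation of the 5-vertex gadget. -/
def S5rel (a b : Fin 5) : Prop :=
  (a.1, b.1) ∈ [(0, 1), (0, 2), (1, 3), (1, 4), (2, 3), (2, 4), (3, 4)]

instance : DecidableRel S5rel := fun a b => by unfold S5rel; infer_instance

def S5 : SimpleGraph (Fin 5) := SimpleGraph.fromRel S5rel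

instance : DecidableRel S5.Adj := fun a b => by
  unfold S5; rw [SimpleGraph.fromRel_adj]; infer_instance

/-- The edge relation of the 9-vertex gadget. -/
def S9rel (a b : Fin 9) : Prop :=
  (a.1, b.1) ∈ [(0, 1), (0, 2), (1, 2), (1, 3), (2, 3), (3, 4),
    (4, 5), (4, 6), (5, 7), (5, 8), (6, 7), (6, 8), (7, 8)]

instance : DecidableRel S9rel := fun a b => by unfold S9rel; infer_instance

def S9 : SimpleGraph (Fin 9) := SimpleGraph.fromRel S9rel

instance : DecidableRel S9.Adj := fun a b => by
  unfold S9; rw [SimpleGraph.fromRel_adj]; infer_instance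

lemma ncard_nb {n : ℕ} (G : SimpleGraph (Fin n)) [DecidableRel G.Adj] (u : Fin n) :
    (G.neighborSet u).ncard = (Finset.univ.filter (fun v => G.Adj u v)).card := by
  rw [← Set.ncard_coe_finset]
  congr 1
  ext v
  simp

/-- Connectedness from a decreasing neighbour. -/
lemma conn_of_parent {n : ℕ} (G : SimpleGraph (Fin (n + 1)))
    (h : ∀ u : Fin (n + 1), u ≠ 0 → ∃ v : Fin (n + 1), v < u ∧ G.Adj u v) : G.Connected := by
  have key : ∀ u, G.Reachable u 0 := by
    intro u
    induction u using WellFoundedLT.induction with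
    | ind u ih =>
      by_cases hu : u = 0
      · subst hu; exact Reachable.refl _
      · obtain ⟨v, hv, hadj⟩ := h u hu
        exact hadj.reachable.trans (ih v hv)
  exact ⟨fun a b => (key a).trans (key b).symm⟩

lemma gadget5 : Gadget S5 0 where
  conn := conn_of_parent _ (by decide)
  deg0 := by rw [ncard_nb]; decide
  deg := by
    intro u hu
    rw [ncard_nb]
    revert u
    decide
  split := ⟨∅, by simp, by
    have := Set.ncard_le_card (∅ᶜ : Set (Fin 5)); simp, by simp, 0, 0, by simp⟩

lemma gadget9 : Gadget S9 0 where
  conn := conn_of_parent _ (by decide)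
  deg0 := by rw [ncard_nb]; decide
  deg := by
    intro u hu
    rw [ncard_nb]
    revert u
    decide
  split := by
    refine ⟨((Finset.univ.filter (fun v : Fin 9 => 4 ≤ v) : Finset (Fin 9)) : Set (Fin 9)),
      ?_, ?_, ?_, 4, 3, ?_⟩
    · rw [Set.ncard_coe_finset]; decide
    · rw [← Finset.coe_compl, Set.ncard_coe_finset]; decide
    · simp
    · simp only [Finset.mem_coe]
      decide

end gadgets

/-- Lemma 2: For every `k ≥ 3` and every finite leaf set `X` with `|X| ≥ 2` there exist
two distinct (non-isomorphic) level-`k` phylogenetic networks on `X` with the same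
multisets of distances between every pair of leaves. -/
theorem levelk_not_reconstructible_from_multisets
    (k : ℕ) (hk : 3 ≤ k) (X : Type) [Fintype X] [DecidableEq X]
    (hX : 2 ≤ Fintype.card X) :
    ∃ N N' : LabGraph X, N.IsNetwork ∧ N'.IsNetwork ∧
      N.IsLevel k ∧ N'.IsLevel k ∧
      (∀ x y : X, N.dms x y = N'.dms x y) ∧
      ¬ N.IsomLabelled N' := by
  classical
  obtain ⟨m, hm⟩ := Nat.exists_eq_add_of_le' hX
  have e : X ≃ Fin (m + 2) := Fintype.equivFinOfCardEq hm
  refine ⟨net m e S5 0, net m e S9 0, net_isNetwork _ _ _ _ gadget5, net_isNetwork _ _ _ _ gadget9,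
    net_isLevel _ _ _ _ gadget5 k hk, net_isLevel _ _ _ _ gadget9 k hk, ?_, ?_⟩
  · intro x y
    exact dms_gl _ _ _ _ _ _ _ x y
  · rintro ⟨φ, -⟩
    have h := Fintype.card_congr
      (show (Fin (m + 2) ⊕ Fin (m + 1)) ⊕ Fin 5 ≃ (Fin (m + 2) ⊕ Fin (m + 1)) ⊕ Fin 9 from φ.toEquiv)
    simp at h

end LabGraph
end

section
/- Level-1 phylogenetic networks are reconstructible from their shortest distances: if N and N' are level-1 networks on the same leaf set X and d_m^{N}(x,y) = d_m^{N'}(x,y) for all leaves x, y ∈ X, then N and N' are isomorphic by an isomorphism fixing the leaf labels. -/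
open SimpleGraph

namespace LabGraph

variable {X : Type} [Fintype X] [DecidableEq X]

/-- A set of vertices inducing a connected subgraph that stays connected when any
vertex is removed. -/
def TC {V : Type} (G : SimpleGraph V) (S : Set V) : Prop :=
  (G.induce S).Connected ∧ ∀ x, (G.induce (S \ {x})).Connected

theorem crossing_s3 {V : Type} {G : SimpleGraph V} {S : Set V} (hS : (G.induce S).Connected)
    (P : V → Prop) {a b : V} (ha : a ∈ S) (hb : b ∈ S) (hPa : P a) (hPb : ¬ P b) :
    ∃ a' ∈ S, ∃ b' ∈ S, G.Adj a' b' ∧ P a' ∧ ¬ P b' := by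
  obtain ⟨p⟩ := hS.preconnected ⟨a, ha⟩ ⟨b, hb⟩
  obtain ⟨d, -, h1, h2⟩ := p.exists_boundary_dart {z | P z.1} hPa hPb
  exact ⟨d.fst.1, d.fst.2, d.snd.1, d.snd.2, d.adj, h1, h2⟩

theorem TC_pair {V : Type} {G : SimpleGraph V} {u v : V} (h : G.Adj u v) : TC G {u, v} := by
  have h0 : (G.induce {u, v}).Connected := induce_pair_connected_of_adj h
  have h1 : ∀ w : V, (G.induce {w}).Connected := fun w => by
    have : Subsingleton ({w} : Set V) := by infer_instance
    have : Nonempty ({w} : Set V) := ⟨⟨w, rfl⟩⟩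
    exact { preconnected := Preconnected.of_subsingleton }
  refine ⟨h0, fun x => ?_⟩
  by_cases hu : x = u
  · have : ({u, v} \ {x} : Set V) = {v} := by
      ext z; have := h.ne; simp; grind
    rw [this]; exact h1 v
  · by_cases hv : x = v
    · have : ({u, v} \ {x} : Set V) = {u} := by
        ext z; have := h.ne; simp; grind
      rw [this]; exact h1 u
    · have : ({u, v} \ {x} : Set V) = {u, v} := by
        ext z; simp; grind
      rw [this]; exact h0

theorem TC_ear {V : Type} {G : SimpleGraph V} {S : Set V} (hS : TC G S) {s t : V}
    (hs : s ∈ S) (ht : t ∈ S) (p : G.Walk s t) (hp : p.IsPath) :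
    TC G (S ∪ {z | z ∈ p.support}) := by
  classical
  refine ⟨induce_union_connected hS.1.preconnected p.connected_induce_support.preconnected
    ⟨s, hs, p.start_mem_support⟩, fun x => ?_⟩
  have hc := hS.2 x
  obtain ⟨⟨u, hu⟩⟩ := hc.nonempty
  refine induce_connected_of_patches u ⟨Or.inl hu.1, hu.2⟩ ?_
  rintro w ⟨hw | hw, hwx⟩
  · exact ⟨S \ {x}, fun z hz => ⟨Or.inl hz.1, hz.2⟩, hu, ⟨hw, hwx⟩, hc.preconnected _ _⟩
  · have hw : w ∈ p.support := hw
    have key : x ∉ (p.takeUntil w hw).support ∨ x ∉ (p.dropUntil w hw).support := by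
      by_contra! hcon
      have hwx' : x ≠ w := fun h => hwx h.symm
      have h1 := hp
      rw [← p.take_spec hw] at h1
      have h2 := h1.support_nodup
      rw [Walk.support_append] at h2
      have h3 := List.disjoint_of_nodup_append h2
      have h4 : x ∈ (p.dropUntil w hw).support.tail := by
        have := hcon.2
        rw [← Walk.cons_tail_support] at this
        rcases List.mem_cons.1 this with h | h
        · exact absurd h hwx'
        · exact h
      exact h3 hcon.1 h4
    rcases key with key | key
    · have hsx : s ≠ x := fun h => key (h ▸ Walk.start_mem_support _)
      have hu2 := induce_union_connected hc.preconnected (p.takeUntil w hw).connected_induce_support.preconnected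
        ⟨s, ⟨hs, hsx⟩, Walk.start_mem_support _⟩
      refine ⟨_, ?_, Or.inl hu, Or.inr (Walk.end_mem_support _), hu2.preconnected _ _⟩
      rintro z (hz | hz)
      · exact ⟨Or.inl hz.1, hz.2⟩
      · exact ⟨Or.inr (p.support_takeUntil_subset_support hw hz), fun h => key (h ▸ hz)⟩
    · have hsx : t ≠ x := fun h => key (h ▸ Walk.end_mem_support _)
      have hu2 := induce_union_connected hc.preconnected (p.dropUntil w hw).connected_induce_support.preconnected
        ⟨t, ⟨ht, hsx⟩, Walk.end_mem_support _⟩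
      refine ⟨_, ?_, Or.inl hu, Or.inr (Walk.start_mem_support _), hu2.preconnected _ _⟩
      rintro z (hz | hz)
      · exact ⟨Or.inl hz.1, hz.2⟩
      · exact ⟨Or.inr (p.support_dropUntil_subset_support hw hz), fun h => key (h ▸ hz)⟩

/-- Existence of gates for a maximal `TC` set. -/
theorem gates {V : Type} {G : SimpleGraph V} (hG : G.Connected) {S : Set V}
    (hS : Maximal (TC G) S) :
    ∃ γ : V → V, (∀ y, γ y ∈ S) ∧ (∀ s ∈ S, γ s = s) ∧
      ∀ y z, γ y ≠ γ z →
        G.dist y z = G.dist y (γ y) + G.dist (γ y) (γ z) + G.dist (γ z) z := by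
  classical
  let G' : SimpleGraph V :=
    { Adj := fun a b => G.Adj a b ∧ ¬ (a ∈ S ∧ b ∈ S)
      symm := ⟨fun a b h => ⟨h.1.symm, fun h' => h.2 ⟨h'.2, h'.1⟩⟩⟩
      loopless := ⟨fun a h => h.1.ne rfl⟩ }
  have hle : G' ≤ G := fun a b h => h.1
  have hex : ∀ y, ∃ s ∈ S, G'.Reachable y s := by
    obtain ⟨⟨s0, hs0⟩⟩ := hS.prop.1.nonempty
    intro y
    obtain ⟨p⟩ := hG.preconnected y s0
    induction p with
    | nil => exact ⟨_, hs0, Reachable.refl _⟩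
    | @cons a b c hab q ih =>
      by_cases ha : a ∈ S
      · exact ⟨a, ha, Reachable.refl _⟩
      · obtain ⟨s, hs, hr⟩ := ih hs0
        have : G'.Adj a b := ⟨hab, fun h => ha h.1⟩
        exact ⟨s, hs, this.reachable.trans hr⟩
  have huniq : ∀ s ∈ S, ∀ t ∈ S, G'.Reachable s t → s = t := by
    intro s hs t ht hr
    obtain ⟨p, hp⟩ := hr.exists_isPath
    have hear := TC_ear hS.prop hs ht (p.mapLe hle) (hp.mapLe hle)
    have hsub := hS.le_of_ge hear (fun z hz => Or.inl hz)
    cases p with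
    | nil => rfl
    | @cons _ b _ hab q =>
      exact absurd ⟨hs, hsub (Or.inr (by simp))⟩ hab.2
  choose γ hγS hγr using hex
  have hfix : ∀ s ∈ S, γ s = s := fun s hs => (huniq _ hs _ (hγS s) (hγr s)).symm
  have hcross : ∀ y z, G.Adj y z → γ y ≠ γ z → y ∈ S ∧ z ∈ S := by
    intro y z h hne
    by_contra hcon
    have : G'.Adj y z := ⟨h, hcon⟩
    exact hne (huniq _ (hγS y) _ (hγS z) (((hγr y).symm.trans this.reachable).trans (hγr z)))
  have hpass : ∀ y z, γ y ≠ γ z → G.dist y z = G.dist y (γ y) + G.dist (γ y) z := by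
    intro y z hne
    refine le_antisymm hG.dist_triangle ?_
    obtain ⟨p, hp⟩ := hG.exists_walk_length_eq_dist y z
    obtain ⟨d, hd, h1, h2⟩ := p.exists_boundary_dart {w | γ w = γ y} rfl (fun h => hne h.symm)
    have h1 : γ d.fst = γ y := h1
    have h2 : ¬ γ d.snd = γ y := h2
    have h3 := (hcross _ _ d.adj (fun h => h2 (h.symm.trans h1))).1
    have h4 : γ y ∈ p.support := by
      rw [← h1, hfix _ h3]; exact p.dart_fst_mem_support_of_mem_darts hd
    have h5 := congrArg Walk.length (p.take_spec h4)
    rw [Walk.length_append] at h5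
    have h6 := dist_le (p.takeUntil _ h4)
    have h7 := dist_le (p.dropUntil _ h4)
    omega
  refine ⟨γ, hγS, hfix, fun y z hne => ?_⟩
  have h1 := hpass y z hne
  have h2 := hpass z (γ y) (by rw [hfix _ (hγS y)]; exact hne.symm)
  have e1 := G.dist_comm (u := z) (v := γ y)
  have e2 := G.dist_comm (u := z) (v := γ z)
  have e3 := G.dist_comm (u := γ y) (v := γ z)
  omega

/-- In a `TC` set with at least three vertices each vertex has two neighbours in the set. -/
theorem TC_two {V : Type} {G : SimpleGraph V} {S : Set V} (hS : TC G S)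
    (h3 : ∀ a b, ∃ z ∈ S, z ≠ a ∧ z ≠ b) {c : V} (hc : c ∈ S) :
    ∃ p ∈ S, ∃ q ∈ S, p ≠ q ∧ G.Adj c p ∧ G.Adj c q := by
  obtain ⟨z, hz, hzc, -⟩ := h3 c c
  obtain ⟨a, -, p, hp, hadj, rfl, -⟩ := crossing_s3 hS.1 (· = c) hc hz rfl hzc
  obtain ⟨w, hw, hwa, hwp⟩ := h3 a p
  obtain ⟨a', -, q, hq, hadj', rfl, -⟩ := crossing_s3 (hS.2 p) (· = a)
    (a := a) (b := w) ⟨hc, hadj.ne⟩ ⟨hw, hwp⟩ rfl hwa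
  exact ⟨p, hp, q, hq.1, fun h => hq.2 h.symm, hadj, hadj'⟩

theorem exit_block {Y : Type} (N : LabGraph Y) (hlev : N.IsLevel 1) {S : Set N.V}
    (hS : Maximal (TC N.G) S) {c : N.V} (hc : c ∈ S) (hdeg : N.degOf c = 3) :
    ∃ w, N.G.Adj c w ∧ w ∉ S := by
  classical
  by_contra! hcon
  have hsub : N.G.neighborSet c ⊆ S := fun w hw => hcon w hw
  have hcard : 3 ≤ S.ncard := by
    have := Set.ncard_le_ncard hsub
    unfold degOf at hdeg
    omega
  have h3 : ∀ a b, ∃ z ∈ S, z ≠ a ∧ z ≠ b := by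
    intro a b
    by_contra! h
    have h1 : S ⊆ {a, b} := fun z hz => by
      have := h z hz
      simp; tauto
    have := Set.ncard_le_ncard h1
    have : ({a, b} : Set N.V).ncard ≤ 2 := (Set.ncard_insert_le a {b}).trans (by simp)
    omega
  let H : N.G.Subgraph := (⊤ : N.G.Subgraph).induce S
  have hblob : N.IsBlob H := by
    refine ⟨⟨hcard, ?_, ?_⟩, ?_⟩
    · have := hS.prop.1
      rwa [induce_eq_coe_induce_top] at this
    · intro v hv
      have := hS.prop.2 v
      rw [induce_eq_coe_induce_top] at this
      have e : H.deleteVerts {v} = (⊤ : N.G.Subgraph).induce (S \ {v}) := by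
        ext a b
        · simp [H]
        · simp [H]; grind
      rw [e]; exact this
    · intro H' hH' hle
      have hTC : TC N.G H'.verts := by
        have hc1 : (N.G.induce H'.verts).Connected :=
          Subgraph.Connected.induce_verts ⟨hH'.2.1⟩
        refine ⟨hc1, fun x => ?_⟩
        by_cases hx : x ∈ H'.verts
        · exact Subgraph.Connected.induce_verts ⟨hH'.2.2 x hx⟩
        · have : H'.verts \ {x} = H'.verts := by
            ext z; simp; grind
          rw [this]; exact hc1
      have hv : H'.verts ≤ S := hS.le_of_ge hTC hle.1
      refine le_antisymm ?_ hle
      exact (Subgraph.le_induce_top_verts).trans (Subgraph.induce_mono_right hv)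
  have hE := hlev H hblob
  have e1 : H.edgeSet.ncard = (N.G.induce S).edgeFinset.card := by
    rw [← Subgraph.image_coe_edgeSet_coe,
      Set.ncard_image_of_injective _ (Sym2.map.injective Subtype.val_injective)]
    rw [← Set.ncard_coe_finset, coe_edgeFinset]
    have : H.coe = N.G.induce S := (induce_eq_coe_induce_top S).symm
    rw [← this]; rfl
  have e2 : H.verts.ncard = Fintype.card S := by
    rw [← Nat.card_coe_set_eq, Nat.card_eq_fintype_card]; rfl
  have hsum := (N.G.induce S).sum_degrees_eq_twice_card_edges
  have hge : ∀ s : S, 2 ≤ (N.G.induce S).degree s := by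
    intro s
    obtain ⟨p, hp, q, hq, hne, h1, h2⟩ := TC_two hS.prop h3 s.2
    have : ({⟨p, hp⟩, ⟨q, hq⟩} : Finset S) ⊆ (N.G.induce S).neighborFinset s := by
      intro z hz
      simp only [Finset.mem_insert, Finset.mem_singleton] at hz
      rcases hz with rfl | rfl <;> simpa
    have h4 := Finset.card_le_card this
    rw [Finset.card_pair (by simpa using hne)] at h4
    exact h4
  have hc3 : 3 ≤ (N.G.induce S).degree ⟨c, hc⟩ := by
    have h5 : N.G.neighborSet c ⊆ Subtype.val '' ((N.G.induce S).neighborSet ⟨c, hc⟩) := by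
      intro w hw
      exact ⟨⟨w, hsub hw⟩, hw, rfl⟩
    have h6 := Set.ncard_le_ncard h5
    rw [Set.ncard_image_of_injective _ Subtype.val_injective] at h6
    rw [← card_neighborSet_eq_degree, ← Nat.card_eq_fintype_card, Nat.card_coe_set_eq]
    unfold degOf at hdeg
    omega
  have hlt : ∑ s : S, 2 < ∑ s : S, (N.G.induce S).degree s :=
    Finset.sum_lt_sum (fun s _ => hge s) ⟨⟨c, hc⟩, Finset.mem_univ _, hc3⟩
  simp only [Finset.sum_const, Finset.card_univ, smul_eq_mul] at hlt
  omega

theorem first_step {V : Type} {G : SimpleGraph V} (hG : G.Connected) {u y : V} (h : u ≠ y) :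
    ∃ w, G.Adj u w ∧ G.dist w y + 1 = G.dist u y := by
  obtain ⟨p, hp⟩ := hG.exists_walk_length_eq_dist u y
  cases p with
  | nil => exact absurd rfl h
  | @cons _ w _ hadj q =>
    refine ⟨w, hadj, ?_⟩
    have h1 := dist_le q
    have h2 : G.dist u y ≤ G.dist u w + G.dist w y := hG.dist_triangle
    have h3 := dist_eq_one_iff_adj.2 hadj
    rw [Walk.length_cons] at hp
    omega

/-- `S` is a block with gate map `γ`. -/
structure Gated {V : Type} (G : SimpleGraph V) (S : Set V) (γ : V → V) : Prop where
  conn : (G.induce S).Connected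
  mem : ∀ y, γ y ∈ S
  fix : ∀ s ∈ S, γ s = s
  dist : ∀ y z, γ y ≠ γ z →
    G.dist y z = G.dist y (γ y) + G.dist (γ y) (γ z) + G.dist (γ z) z

theorem Gated.dist_left {V : Type} {G : SimpleGraph V} {S : Set V} {γ : V → V}
    (h : Gated G S γ) {s : V} (hs : s ∈ S) (y : V) :
    G.dist y s = G.dist y (γ y) + G.dist (γ y) s := by
  by_cases hne : γ y = s
  · rw [hne, dist_self]; rfl
  · have h1 := h.dist y s (by rw [h.fix s hs]; exact hne)
    rw [h.fix s hs, dist_self] at h1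
    exact h1

theorem Gated.exit {V : Type} {G : SimpleGraph V} (hG : G.Connected) {S : Set V} {γ : V → V}
    (h : Gated G S γ) {c w : V} (hc : c ∈ S) (hw : w ∉ S) (hadj : G.Adj c w) : γ w = c := by
  by_contra hne
  have h1 := h.dist_left hc w
  have h2 := dist_eq_one_iff_adj.2 hadj.symm
  have h3 := hG.pos_dist_of_ne hne
  have h4 := hG.pos_dist_of_ne (u := w) (v := γ w) (fun e => hw (e ▸ h.mem w))
  omega

theorem Gated.toward {V : Type} {G : SimpleGraph V} {S : Set V} {γ : V → V}
    (h : Gated G S γ) {v u y : V} (hu : u ∈ S) (hlt : G.dist u y < G.dist v y) :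
    γ y ≠ v := by
  intro e
  have h1 := h.dist_left hu y
  rw [e] at h1
  have e1 := G.dist_comm (u := u) (v := y)
  have e2 := G.dist_comm (u := v) (v := y)
  omega

theorem exists_block {Y : Type} (N : LabGraph Y) (hG : N.G.Connected) (hlev : N.IsLevel 1)
    {u v : N.V} (hadj : N.G.Adj u v) :
    ∃ S γ, u ∈ S ∧ v ∈ S ∧ Gated N.G S γ ∧
      ∀ c ∈ S, N.degOf c = 3 → ∃ w, N.G.Adj c w ∧ w ∉ S := by
  obtain ⟨S, hle, hS⟩ := Finite.exists_le_maximal (TC_pair hadj)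
  obtain ⟨γ, h1, h2, h3⟩ := gates hG hS
  exact ⟨S, γ, hle (by simp), hle (by simp), ⟨hS.prop.1, h1, h2, h3⟩,
    fun c hc hd => exit_block N hlev hS hc hd⟩

/-- Every block has leaves behind each of its vertices. -/
theorem exists_leafy_block {Y : Type} (N : LabGraph Y) (hG : N.G.Connected)
    (hlev : N.IsLevel 1) (hdeg : ∀ v : N.V, v ∉ Set.range N.leaf → N.degOf v = 3)
    {u v : N.V} (hadj : N.G.Adj u v) :
    ∃ S γ, u ∈ S ∧ v ∈ S ∧ Gated N.G S γ ∧ ∀ c ∈ S, ∃ x, γ (N.leaf x) = c := by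
  obtain ⟨S, γ, hu, hv, hg, hex⟩ := exists_block N hG hlev hadj
  refine ⟨S, γ, hu, hv, hg, fun c hc => ?_⟩
  by_contra! hno
  obtain ⟨z, hz, hmax⟩ := Set.exists_max_image {z | γ z = c} (fun z => N.G.dist z c)
    (Set.toFinite _) ⟨c, hg.fix c hc⟩
  have hz : γ z = c := hz
  have hz3 : N.degOf z = 3 := hdeg z (by rintro ⟨x, rfl⟩; exact hno x hz)
  by_cases hzc : z = c
  · subst hzc
    obtain ⟨w, hw, hwS⟩ := hex z hc hz3
    have h1 := hmax w (hg.exit hG hc hwS hw)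
    have h2 := dist_eq_one_iff_adj.2 hw.symm
    simp only [dist_self] at h1
    omega
  · obtain ⟨t, ht, hlt⟩ := first_step hG hzc
    obtain ⟨S', γ', hzS, htS, hg', hex'⟩ := exists_block N hG hlev ht
    obtain ⟨w, hw, hwS⟩ := hex' z hzS hz3
    have hγw := hg'.exit hG hzS hwS hw
    have hne : γ' c ≠ z := hg'.toward htS (by omega)
    have h1 := hg'.dist w c (by rw [hγw]; exact hne.symm)
    have h2 := hg'.dist z c (by rw [hg'.fix z hzS]; exact hne.symm)
    have h3 := dist_eq_one_iff_adj.2 hw.symm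
    rw [hγw] at h1
    rw [hg'.fix z hzS, dist_self] at h2
    have hwc : γ w = c := by
      by_contra hwc
      have h4 := hg.dist w z (by rw [hz]; exact hwc)
      rw [hz] at h4
      have h5 := hG.pos_dist_of_ne hwc
      have h6 := hG.pos_dist_of_ne (u := c) (v := z) (fun e => hzc e.symm)
      omega
    have h7 := hmax w hwc
    omega

/-- Every geodesic extends to a leaf. -/
theorem extend_geodesic {Y : Type} (N : LabGraph Y) (hG : N.G.Connected)
    (hlev : N.IsLevel 1) (hdeg : ∀ v : N.V, v ∉ Set.range N.leaf → N.degOf v = 3)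
    {u v : N.V} (huv : u ≠ v) :
    ∃ x, N.G.dist (N.leaf x) v = N.G.dist (N.leaf x) u + N.G.dist u v := by
  obtain ⟨w, hw, hlt⟩ := first_step hG huv
  obtain ⟨S, γ, hu, hwS, hg, hl⟩ := exists_leafy_block N hG hlev hdeg hw
  obtain ⟨x, hx⟩ := hl u hu
  have hne : γ v ≠ u := hg.toward hwS (by omega)
  refine ⟨x, ?_⟩
  have h1 := hg.dist (N.leaf x) v (by rw [hx]; exact hne.symm)
  have h2 := hg.dist u v (by rw [hg.fix u hu]; exact hne.symm)
  rw [hx] at h1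
  rw [hg.fix u hu, dist_self] at h2
  omega

/-- Every vertex splits the leaves. -/
theorem vertex_split {Y : Type} (N : LabGraph Y) (hG : N.G.Connected)
    (hlev : N.IsLevel 1) (hdeg : ∀ v : N.V, v ∉ Set.range N.leaf → N.degOf v = 3)
    {u v : N.V} (huv : u ≠ v) :
    ∃ A : Set Y, A.Nonempty ∧ Aᶜ.Nonempty ∧ ∀ a ∈ A, ∀ b ∉ A,
      N.G.dist (N.leaf a) u + N.G.dist (N.leaf b) u = N.dm a b := by
  obtain ⟨w, hw, -⟩ := first_step hG huv
  obtain ⟨S, γ, hu, hwS, hg, hl⟩ := exists_leafy_block N hG hlev hdeg hw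
  obtain ⟨x, hx⟩ := hl u hu
  obtain ⟨y, hy⟩ := hl w hwS
  refine ⟨{a | γ (N.leaf a) = u}, ⟨x, hx⟩, ⟨y, fun h => hw.ne ?_⟩, ?_⟩
  · exact (Eq.symm (h : γ (N.leaf y) = u)).trans hy
  · intro a ha b hb
    have ha : γ (N.leaf a) = u := ha
    have hb : ¬ γ (N.leaf b) = u := hb
    have h1 := hg.dist (N.leaf a) (N.leaf b) (by rw [ha]; exact fun e => hb e.symm)
    have h2 := hg.dist_left hu (N.leaf b)
    rw [ha] at h1
    have e1 := N.G.dist_comm (u := u) (v := γ (N.leaf b))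
    have e2 := N.G.dist_comm (u := N.leaf b) (v := γ (N.leaf b))
    unfold dm
    omega

/-- The Helly-type property: a function that is tight along a split is dominated from below
by the distance function of a vertex. -/
theorem helly {Y : Type} [Finite Y] (N : LabGraph Y) (hG : N.G.Connected)
    (hlev : N.IsLevel 1) (hdeg : ∀ v : N.V, v ∉ Set.range N.leaf → N.degOf v = 3)
    (f : Y → ℕ) (hf : ∀ x y, N.dm x y ≤ f x + f y)
    (A : Set Y) (hA : A.Nonempty) (hB : Aᶜ.Nonempty)
    (htight : ∀ a ∈ A, ∀ b ∉ A, f a + f b = N.dm a b) :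
    ∃ v, ∀ x, N.G.dist (N.leaf x) v ≤ f x := by
  classical
  have hex : ∃ m : ℕ, ∃ v, ∀ x, N.G.dist (N.leaf x) v ≤ f x + m := by
    obtain ⟨v0⟩ := hG.nonempty
    obtain ⟨M, hM⟩ := (Set.finite_range fun x => N.G.dist (N.leaf x) v0).bddAbove
    exact ⟨M, v0, fun x => (hM ⟨x, rfl⟩).trans (by omega)⟩
  obtain ⟨v, hv⟩ := Nat.find_spec hex
  have hmin : ∀ k, k < Nat.find hex → ∀ w, ∃ x, f x + k < N.G.dist (N.leaf x) w := by
    intro k hk w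
    have := Nat.find_min hex hk
    push Not at this
    exact this w
  generalize Nat.find hex = m at hv hmin
  rcases Nat.eq_zero_or_pos m with rfl | hm
  · exact ⟨v, hv⟩
  exfalso
  obtain ⟨x, hx⟩ := hmin (m - 1) (by omega) v
  have hxm : N.G.dist (N.leaf x) v = f x + m := by
    have := hv x
    omega
  have hxv : v ≠ N.leaf x := by
    intro e
    rw [← e, dist_self] at hxm
    omega
  obtain ⟨u, hadj, hlt⟩ := first_step hG hxv
  obtain ⟨S, γ, hvS, huS, hg, hl⟩ := exists_leafy_block N hG hlev hdeg hadj
  have hcx : γ (N.leaf x) ≠ v := hg.toward huS (by omega)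
  -- the height of a leaf over its gate
  let D : Y → ℕ := fun y => N.G.dist (N.leaf y) (γ (N.leaf y))
  have hdist : ∀ y, ∀ s ∈ S, N.G.dist (N.leaf y) s = D y + N.G.dist (γ (N.leaf y)) s :=
    fun y s hs => hg.dist_left hs _
  have hpair : ∀ y z, γ (N.leaf y) ≠ γ (N.leaf z) →
      N.dm y z = D y + N.G.dist (γ (N.leaf y)) (γ (N.leaf z)) + D z := by
    intro y z hne
    have := hg.dist _ _ hne
    rw [N.G.dist_comm (u := γ (N.leaf z)) (v := N.leaf z)] at this
    exact this
  have hlow : ∀ y, D y ≤ f y := by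
    intro y
    by_contra! hy
    by_cases hyv : γ (N.leaf y) = v
    · have h1 := hpair x y (by rw [hyv]; exact hcx)
      have h2 := hf x y
      have h3 := hdist x v hvS
      rw [hyv] at h1
      omega
    · obtain ⟨z, hz⟩ := hmin (m - 1) (by omega) (γ (N.leaf y))
      have h1 := hdist z _ (hg.mem (N.leaf y))
      by_cases hzy : γ (N.leaf z) = γ (N.leaf y)
      · have h2 := hdist z v hvS
        have h3 := hv z
        have h4 := hG.pos_dist_of_ne hyv
        rw [hzy] at h1 h2
        rw [dist_self] at h1
        omega
      · have h2 := hpair z y hzy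
        have h3 := hf z y
        omega
  have hstrict : ∀ y, D y < f y := by
    intro y
    by_contra! hy
    obtain ⟨z, hz⟩ := hmin 0 hm (γ (N.leaf y))
    have h1 := hdist z _ (hg.mem (N.leaf y))
    have h5 := hlow z
    by_cases hzy : γ (N.leaf z) = γ (N.leaf y)
    · rw [hzy, dist_self] at h1
      omega
    · have h2 := hpair z y hzy
      have h3 := hf z y
      omega
  have hmix : ∀ a ∈ A, ∀ b ∉ A, γ (N.leaf a) ≠ γ (N.leaf b) := by
    intro a ha b hb e
    have h1 := htight a ha b hb
    have h2 := hstrict a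
    have h3 := hstrict b
    have h4 : N.dm a b ≤ N.G.dist (N.leaf a) (γ (N.leaf a)) + N.G.dist (γ (N.leaf a)) (N.leaf b) :=
      hG.dist_triangle
    rw [N.G.dist_comm (u := γ (N.leaf a)) (v := N.leaf b), hdist b _ (hg.mem _), e,
      dist_self, ← e] at h4
    have h5 : N.dm a b ≤ D a + (D b + 0) := h4
    omega
  obtain ⟨a, ha⟩ := hA
  obtain ⟨b, hb⟩ := hB
  obtain ⟨c, hc, d, hd, hcd, ⟨a', ha', hac⟩, hnd⟩ := crossing_s3 hg.conn
    (fun c => ∃ a ∈ A, γ (N.leaf a) = c) (hg.mem (N.leaf a)) (hg.mem (N.leaf b))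
    ⟨a, ha, rfl⟩ (by rintro ⟨a', ha', e⟩; exact hmix a' ha' b hb e)
  obtain ⟨b', hbd⟩ := hl d hd
  have hb' : b' ∉ A := fun h => hnd ⟨b', h, hbd⟩
  have h1 := hpair a' b' (hmix a' ha' b' hb')
  rw [hac, hbd, dist_eq_one_iff_adj.2 hcd] at h1
  have h2 := htight a' ha' b' hb'
  have h3 := hstrict a'
  have h4 := hstrict b'
  omega

/-- The distance functions of vertices of `N` are distance functions of vertices of `N'`. -/
theorem transfer {Y : Type} [Finite Y] (N N' : LabGraph Y) (hG : N.G.Connected)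
    (hlev : N.IsLevel 1) (hdeg : ∀ v : N.V, v ∉ Set.range N.leaf → N.degOf v = 3)
    (hG' : N'.G.Connected)
    (hlev' : N'.IsLevel 1) (hdeg' : ∀ v : N'.V, v ∉ Set.range N'.leaf → N'.degOf v = 3)
    (hd : ∀ x y : Y, N.dm x y = N'.dm x y) (hnt : Nontrivial N.V) (u : N.V) :
    ∃ u' : N'.V, ∀ x, N'.G.dist (N'.leaf x) u' = N.G.dist (N.leaf x) u := by
  obtain ⟨v, hv⟩ := exists_ne u
  obtain ⟨A, hA, hB, hAB⟩ := vertex_split N hG hlev hdeg hv.symm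
  obtain ⟨u', hu'⟩ := helly N' hG' hlev' hdeg' (fun x => N.G.dist (N.leaf x) u)
    (fun x y => by
      rw [← hd]
      have h : N.dm x y ≤ N.G.dist (N.leaf x) u + N.G.dist u (N.leaf y) := hG.dist_triangle
      rwa [N.G.dist_comm (u := u)] at h) A hA hB
    (fun a ha b hb => by rw [← hd]; exact hAB a ha b hb)
  refine ⟨u', ?_⟩
  have key : ∀ a ∈ A, ∀ b ∉ A, N'.G.dist (N'.leaf a) u' = N.G.dist (N.leaf a) u ∧
      N'.G.dist (N'.leaf b) u' = N.G.dist (N.leaf b) u := by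
    intro a ha b hb
    have h1 := hAB a ha b hb
    have h2 := hu' a
    have h3 := hu' b
    have h4 : N'.dm a b ≤ N'.G.dist (N'.leaf a) u' + N'.G.dist u' (N'.leaf b) :=
      hG'.dist_triangle
    rw [N'.G.dist_comm (u := u')] at h4
    rw [hd] at h1
    omega
  intro x
  by_cases hx : x ∈ A
  · obtain ⟨b, hb⟩ := hB
    exact (key x hx b hb).1
  · obtain ⟨a, ha⟩ := hA
    exact (key a ha x hx).2

theorem dist_le_of_match {Y : Type} (N N' : LabGraph Y) (hG : N.G.Connected)
    (hlev : N.IsLevel 1) (hdeg : ∀ v : N.V, v ∉ Set.range N.leaf → N.degOf v = 3)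
    (hG' : N'.G.Connected) {u v : N.V} {u' v' : N'.V}
    (hu : ∀ x, N'.G.dist (N'.leaf x) u' = N.G.dist (N.leaf x) u)
    (hv : ∀ x, N'.G.dist (N'.leaf x) v' = N.G.dist (N.leaf x) v) :
    N.G.dist u v ≤ N'.G.dist u' v' := by
  by_cases huv : u = v
  · rw [huv, dist_self]; omega
  · obtain ⟨x, hx⟩ := extend_geodesic N hG hlev hdeg huv
    have h1 : N'.G.dist (N'.leaf x) v' ≤ N'.G.dist (N'.leaf x) u' + N'.G.dist u' v' :=
      hG'.dist_triangle
    rw [hu, hv] at h1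
    omega

theorem isom_nontrivial {Y : Type} [Finite Y] (N N' : LabGraph Y) (hG : N.G.Connected)
    (hlev : N.IsLevel 1) (hdeg : ∀ v : N.V, v ∉ Set.range N.leaf → N.degOf v = 3)
    (hG' : N'.G.Connected)
    (hlev' : N'.IsLevel 1) (hdeg' : ∀ v : N'.V, v ∉ Set.range N'.leaf → N'.degOf v = 3)
    (hd : ∀ x y : Y, N.dm x y = N'.dm x y) (hnt : Nontrivial N.V) (hnt' : Nontrivial N'.V) :
    N.IsomLabelled N' := by
  choose φ hφ using transfer N N' hG hlev hdeg hG' hlev' hdeg' hd hnt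
  choose ψ hψ using transfer N' N hG' hlev' hdeg' hG hlev hdeg (fun x y => (hd x y).symm) hnt'
  have hinj : ∀ u v : N.V, (∀ x, N.G.dist (N.leaf x) u = N.G.dist (N.leaf x) v) → u = v := by
    intro u v h
    have := dist_le_of_match N N hG hlev hdeg hG (u := u) (v := v) (u' := u) (v' := u)
      (fun x => rfl) h
    rw [dist_self] at this
    exact hG.dist_eq_zero_iff.1 (by omega)
  have hinj' : ∀ u v : N'.V, (∀ x, N'.G.dist (N'.leaf x) u = N'.G.dist (N'.leaf x) v) →
      u = v := by
    intro u v h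
    have := dist_le_of_match N' N' hG' hlev' hdeg' hG' (u := u) (v := v) (u' := u) (v' := u)
      (fun x => rfl) h
    rw [dist_self] at this
    exact hG'.dist_eq_zero_iff.1 (by omega)
  have hdist : ∀ u v, N'.G.dist (φ u) (φ v) = N.G.dist u v := by
    intro u v
    refine le_antisymm ?_ ?_
    · exact dist_le_of_match N' N hG' hlev' hdeg' hG (fun x => (hφ u x).symm)
        (fun x => (hφ v x).symm)
    · exact dist_le_of_match N N' hG hlev hdeg hG' (hφ u) (hφ v)
  let e : N.V ≃ N'.V :=
    { toFun := φ
      invFun := ψ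
      left_inv := fun u => hinj _ _ (fun x => by rw [hψ, hφ])
      right_inv := fun u => hinj' _ _ (fun x => by rw [hφ, hψ]) }
  refine ⟨⟨e, ?_⟩, fun x => ?_⟩
  · intro a b
    change N'.G.Adj (φ a) (φ b) ↔ N.G.Adj a b
    rw [← dist_eq_one_iff_adj, ← dist_eq_one_iff_adj, hdist]
  · change φ (N.leaf x) = N'.leaf x
    exact hinj' _ _ (fun y => by rw [hφ]; exact hd y x)

/-- Facts about a network: either a singleton, or nontrivial with degree conditions. -/
theorem network_cases {Y : Type} [Fintype Y] (N : LabGraph Y) (hN : N.IsNetwork) :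
    (Fintype.card Y = 1 ∧ Fintype.card N.V = 1) ∨
      (Nontrivial N.V ∧ ∀ v : N.V, v ∉ Set.range N.leaf → N.degOf v = 3) := by
  obtain ⟨hG, -, h | ⟨h1, h3⟩⟩ := hN
  · exact Or.inl h
  · refine Or.inr ⟨?_, h3⟩
    obtain ⟨v⟩ := hG.nonempty
    have hpos : 0 < (N.G.neighborSet v).ncard := by
      by_cases hv : v ∈ Set.range N.leaf
      · obtain ⟨x, rfl⟩ := hv
        have := h1 x
        unfold degOf at this
        omega
      · have := h3 v hv
        unfold degOf at this
        omega
    obtain ⟨w, hw⟩ := Set.nonempty_of_ncard_ne_zero hpos.ne'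
    exact ⟨v, w, (show N.G.Adj v w from hw).ne⟩

theorem two_leaves {Y : Type} [Fintype Y] (N : LabGraph Y) (hG : N.G.Connected)
    (hlev : N.IsLevel 1) (hdeg : ∀ v : N.V, v ∉ Set.range N.leaf → N.degOf v = 3)
    (hnt : Nontrivial N.V) : Fintype.card Y ≠ 1 := by
  intro h
  obtain ⟨u, v, huv⟩ := hnt.exists_pair_ne
  obtain ⟨A, ⟨a, ha⟩, ⟨b, hb⟩, -⟩ := vertex_split N hG hlev hdeg huv
  have : Subsingleton Y := Fintype.card_le_one_iff_subsingleton.1 h.le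
  exact hb (Subsingleton.elim a b ▸ ha)

/-- Theorem: Level-1 networks are reconstructible from their shortest distances. -/
theorem level1_reconstructible_from_shortest_distances
    (X : Type) [Fintype X] [DecidableEq X]
    (N N' : LabGraph X) (hN : N.IsNetwork) (hN' : N'.IsNetwork)
    (hlev : N.IsLevel 1) (hlev' : N'.IsLevel 1)
    (hd : ∀ x y : X, N.dm x y = N'.dm x y) :
    N.IsomLabelled N' := by
  rcases network_cases N hN with ⟨hX, h1⟩ | ⟨hnt, hdeg⟩
  · rcases network_cases N' hN' with ⟨-, h1'⟩ | ⟨hnt', hdeg'⟩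
    · have hs : Subsingleton N.V := Fintype.card_le_one_iff_subsingleton.1 h1.le
      have hs' : Subsingleton N'.V := Fintype.card_le_one_iff_subsingleton.1 h1'.le
      refine ⟨⟨Fintype.equivOfCardEq (h1.trans h1'.symm), ?_⟩, fun x => Subsingleton.elim _ _⟩
      intro a b
      constructor
      · intro h
        exact absurd (Subsingleton.elim _ _) h.ne
      · intro h
        exact absurd (Subsingleton.elim _ _) h.ne
    · exact absurd hX (two_leaves N' hN'.1 hlev' hdeg' hnt')
  · rcases network_cases N' hN' with ⟨hX, -⟩ | ⟨hnt', hdeg'⟩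
    · exact absurd hX (two_leaves N hN.1 hlev hdeg hnt)
    · exact isom_nontrivial N N' hN.1 hlev hdeg hN'.1 hlev' hdeg' hd hnt hnt'

end LabGraph
end
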